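/- arXiv:2304.09039 — 11 statements merged into one kernel-verified Lean document; each statement's English description precedes it below -/
import Mathlib

section
/- Let B=(1,b_2,...,b_k) with 1<b_2<...<b_k positive integers (k≥2), and let c = max{O_B(r) : 0 ≤ r ≤ b_k−1}. Then for every positive integer r with r ≥ ⌈(c−1)b_{k−1}/(b_k−b_{k−1})⌉ · b_k, one has O_B(b_k + r) = O_B(r) + 1. -/
/-- `OB k b M` is the minimum of `x 1 + ⋯ + x k` over all nonnegative integer
solutions of `x 1 * b 1 + ⋯ + x k * b k = M`. -/
noncomputable def OB (k : ℕ) (b : ℕ → ℕ) (M : ℕ) : ℕ :=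
  sInf {n : ℕ | ∃ x : ℕ → ℕ,
    (∑ i ∈ Finset.Icc 1 k, x i * b i) = M ∧ (∑ i ∈ Finset.Icc 1 k, x i) = n}

theorem OB_le (k : ℕ) (b x : ℕ → ℕ) :
    OB k b (∑ i ∈ Finset.Icc 1 k, x i * b i) ≤ ∑ i ∈ Finset.Icc 1 k, x i :=
  Nat.sInf_le ⟨x, rfl, rfl⟩

/-- The minimum defining `OB` is attained. -/
theorem exists_OB_eq {k : ℕ} {b : ℕ → ℕ} (hk : 1 ≤ k) (hb1 : b 1 = 1) (M : ℕ) :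
    ∃ x : ℕ → ℕ, (∑ i ∈ Finset.Icc 1 k, x i * b i) = M ∧
      (∑ i ∈ Finset.Icc 1 k, x i) = OB k b M := by
  refine Nat.sInf_mem (s := {n : ℕ | ∃ x : ℕ → ℕ,
    (∑ i ∈ Finset.Icc 1 k, x i * b i) = M ∧ (∑ i ∈ Finset.Icc 1 k, x i) = n})
    ⟨_, fun i => if i = 1 then M else 0, ?_, rfl⟩
  simp [ite_mul, hk, hb1]

/-- Adding `q` copies of the largest element costs at most `q`. -/
theorem OB_mul_add_le {k : ℕ} {b : ℕ → ℕ} (hk : 1 ≤ k) (hb1 : b 1 = 1) (q M : ℕ) :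
    OB k b (q * b k + M) ≤ q + OB k b M := by
  obtain ⟨x, hx, hn⟩ := exists_OB_eq hk hb1 M
  have h := OB_le k b (fun i => x i + if i = k then q else 0)
  simp only [add_mul, ite_mul, zero_mul, Finset.sum_add_distrib, Finset.sum_ite_eq',
    Finset.mem_Icc, hk, le_refl, and_self, if_true, hx, hn] at h
  rwa [add_comm M, add_comm (OB k b M)] at h

/-- An optimal representation either uses the largest element, or bounds the represented number
by its length times the second largest element. -/
theorem OB_add_one_le_or_le_mul {m : ℕ} {b : ℕ → ℕ} (hb1 : b 1 = 1)
    (hle : ∀ i ∈ Finset.Icc 1 m, b i ≤ b m) (M : ℕ) :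
    OB (m + 1) b M + 1 ≤ OB (m + 1) b (b (m + 1) + M) ∨
      b (m + 1) + M ≤ OB (m + 1) b (b (m + 1) + M) * b m := by
  obtain ⟨x, hx, hn⟩ := exists_OB_eq (k := m + 1) (by omega) hb1 (b (m + 1) + M)
  rw [← hn]
  rw [Finset.sum_Icc_succ_top (by omega)] at hx ⊢
  rcases Nat.eq_zero_or_pos (x (m + 1)) with h0 | hpos
  · right
    rw [← hx, h0, zero_mul, add_zero, add_zero, Finset.sum_mul]
    exact Finset.sum_le_sum fun i hi => Nat.mul_le_mul_left _ (hle i hi)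
  · left
    obtain ⟨t, ht⟩ := Nat.exists_eq_add_of_lt hpos
    have hne : ∀ i ∈ Finset.Icc 1 m, i ≠ m + 1 := fun i hi => by
      have := (Finset.mem_Icc.mp hi).2
      omega
    have hupd : ∀ i ∈ Finset.Icc 1 m, Function.update x (m + 1) t i = x i :=
      fun i hi => Function.update_of_ne (hne i hi) _ _
    have h := OB_le (m + 1) b (Function.update x (m + 1) t)
    rw [Finset.sum_Icc_succ_top (by omega), Finset.sum_Icc_succ_top (by omega),
      Function.update_self, Finset.sum_congr rfl hupd,
      Finset.sum_congr rfl fun i hi => congrArg (· * b i) (hupd i hi)] at h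
    have hM : ∑ i ∈ Finset.Icc 1 m, x i * b i + t * b (m + 1) = M := by
      rw [ht] at hx
      linarith
    rw [hM] at h
    linarith

theorem stmt_1 (k : ℕ) (b : ℕ → ℕ) (hk : 2 ≤ k) (hb1 : b 1 = 1)
    (hmono : ∀ i, 1 ≤ i → i < k → b i < b (i + 1))
    (c : ℕ) (hc : c = (Finset.range (b k)).sup fun r => OB k b r)
    (r : ℕ) (hr0 : 0 < r)
    (hr : ((c - 1) * b (k - 1)) ⌈/⌉ (b k - b (k - 1)) * b k ≤ r) :
    OB k b (b k + r) = OB k b r + 1 := by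
  obtain ⟨m, rfl⟩ : ∃ m, k = m + 1 := ⟨k - 1, by omega⟩
  rw [Nat.add_sub_cancel] at hr
  have hlt : b m < b (m + 1) := hmono m (by omega) (by omega)
  have hle : ∀ i ∈ Finset.Icc 1 m, b i ≤ b m := by
    intro i hi
    obtain ⟨hi1, him⟩ := Finset.mem_Icc.mp hi
    exact Nat.le_induction (P := fun n _ => n ≤ m → b i ≤ b n) (fun _ => le_rfl)
      (fun n hn ih hnm => (ih (by omega)).trans (hmono n (by omega) (by omega)).le) m him le_rfl
  have hupper := OB_mul_add_le (k := m + 1) (by omega) hb1 1 r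
  rw [one_mul] at hupper
  refine le_antisymm (by omega) ?_
  rcases OB_add_one_le_or_le_mul hb1 hle r with h | h
  · exact h
  by_contra hlow
  have hdiv := OB_mul_add_le (k := m + 1) (by omega) hb1 (r / b (m + 1)) (r % b (m + 1))
  rw [Nat.div_add_mod'] at hdiv
  have hrem : OB (m + 1) b (r % b (m + 1)) ≤ c := hc ▸
    Finset.le_sup (f := fun r => OB (m + 1) b r)
      (Finset.mem_range.mpr (Nat.mod_lt r (by omega)))
  have hq := (Nat.le_div_iff_mul_le (by omega)).mpr hr
  rw [ceilDiv_le_iff_le_mul (by omega)] at hq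
  have hlen : OB (m + 1) b (b (m + 1) + r) ≤ r / b (m + 1) + 1 + (c - 1) := by omega
  have hbound := h.trans (Nat.mul_le_mul_right (b m) hlen)
  have hr_div := Nat.div_mul_le_self r (b (m + 1))
  obtain ⟨d, hd⟩ := Nat.exists_eq_add_of_lt hlt
  rw [show b (m + 1) - b m = d + 1 by omega] at hq
  generalize r / b (m + 1) = q at *
  rw [hd] at hbound hr_div
  nlinarith
end

section
/- Let b ≥ 5 be an odd integer, and let a,h,d be positive integers with gcd(a,d)=1, h ≥ ⌈2d/((b−3)(b+1))⌉ and a ≥ (b−3)(b+1)²/2. Let A(a) = (a, ha+d, ha+2d, ha+bd, ha+(b+1)d) and write j = a mod (b+1). Then g(A(a)) = ⌊a/(b+1)⌋(ha+(b+1)d) + (j−1)d − a if j ∈ {0,1}, and g(A(a)) = ⌊a/(b+1)⌋(ha+(b+1)d) + (j−1)d + (h−1)a if j ∈ {2,3,...,b}. -/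
/-- Every `k ≤ M * (b + 1)` is a sum of at most `M` coins with values in `{1, 2, b, b + 1}`,
provided `M ≥ b - 1`. -/
lemma exists_coins {b M k : ℕ} (hM : b ≤ M + 1) (hk : k ≤ M * (b + 1)) :
    ∃ x1 x2 x3 x4 : ℕ, x1 + x2 + x3 + x4 ≤ M ∧ x1 + 2 * x2 + b * x3 + (b + 1) * x4 = k := by
  obtain ⟨n, i, hi, rfl⟩ : ∃ n i, i < b + 1 ∧ k = (b + 1) * n + i :=
    ⟨k / (b + 1), k % (b + 1), Nat.mod_lt _ (by omega), (Nat.div_add_mod _ _).symm⟩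
  have hn : n ≤ M := by
    by_contra! hlt
    nlinarith
  rcases Nat.eq_zero_or_pos i with rfl | hi0
  · exact ⟨0, 0, 0, n, by omega, by ring⟩
  have hnM : n < M := by
    by_contra! hle
    nlinarith
  by_cases hin : b ≤ i + n
  · obtain ⟨x, rfl⟩ := Nat.exists_eq_add_of_le hin |>.imp fun x hx => (show n = b + x - i by omega)
    obtain ⟨c, hc⟩ := Nat.exists_eq_add_of_le (Nat.lt_succ_iff.mp hi)
    subst hc
    refine ⟨0, 0, c + 1, x, by omega, ?_⟩
    rw [show i + c + x - i = c + x by omega]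
    ring
  · refine ⟨i % 2, i / 2, 0, n, by omega, ?_⟩
    have := Nat.mod_add_div i 2
    linarith

/-- The Frobenius number of `(a, ha + d, ha + 2d, ha + bd, ha + (b + 1)d)` when
`M = ⌈(a - 1) / (b + 1)⌉` is at least `b - 1`. -/
lemma isGreatest_nonrepresentable {a b d M : ℕ} (h : ℕ) (ha : 0 < a) (hb : 0 < b)
    (hgcd : Nat.gcd a d = 1) (hM : b ≤ M + 1) (hle : a ≤ M * (b + 1) + 1)
    (hmin : ∀ m : ℕ, a ≤ m * (b + 1) + 1 → M ≤ m) :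
    IsGreatest {n : ℤ | ¬ ∃ x0 x1 x2 x3 x4 : ℕ,
          n = ((x0 * a + x1 * (h * a + d) + x2 * (h * a + 2 * d)
            + x3 * (h * a + b * d) + x4 * (h * a + (b + 1) * d) : ℕ) : ℤ)}
        ((M : ℤ) * h * a + ((a : ℤ) - 1) * d - a) := by
  have hcop : IsCoprime (a : ℤ) d := Nat.isCoprime_iff_coprime.mpr hgcd
  have haZ : (0 : ℤ) < a := by exact_mod_cast ha
  constructor
  · rintro ⟨x0, x1, x2, x3, x4, hx⟩
    push_cast at hx
    set m := x1 + x2 + x3 + x4 with hm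
    set k := x1 + 2 * x2 + b * x3 + (b + 1) * x4 with hk
    have hx' : (M : ℤ) * h * a + ((a : ℤ) - 1) * d - a = x0 * a + h * a * m + k * d := by
      rw [hx, hm, hk]; push_cast; ring
    have hdvd : (a : ℤ) ∣ (k : ℤ) + 1 :=
      hcop.dvd_of_dvd_mul_right ⟨M * h + d - 1 - x0 - h * m, by linear_combination -hx'⟩
    have hak : a ≤ k + 1 := Nat.le_of_dvd (by omega) (by exact_mod_cast hdvd)
    have hkm : k ≤ m * (b + 1) := by rw [hk, hm]; nlinarith [Nat.mul_le_mul_left x2 hb]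
    have hMm : (M : ℤ) ≤ m := by exact_mod_cast hmin m (by omega)
    have hakZ : (a : ℤ) - 1 ≤ k := by omega
    have h1 : (M : ℤ) * (h * a) ≤ m * (h * a) := by gcongr
    have h2 : ((a : ℤ) - 1) * d ≤ k * d := by gcongr
    have h3 : (0 : ℤ) ≤ x0 * a := by positivity
    linarith
  · intro n hn
    by_contra! hlt
    apply hn
    obtain ⟨u, v, huv⟩ := hcop
    obtain ⟨r, hr⟩ := Int.eq_ofNat_of_zero_le (Int.emod_nonneg (n * v) haZ.ne')
    have hra : (r : ℤ) < a := hr ▸ Int.emod_lt_of_pos _ haZ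
    obtain ⟨x1, x2, x3, x4, hm, hk⟩ := exists_coins (b := b) (M := M) (k := r) hM (by omega)
    set m := x1 + x2 + x3 + x4 with hmdef
    have hdiv := Int.emod_add_mul_ediv (n * v) a
    rw [hr] at hdiv
    obtain ⟨s, hs⟩ : ∃ s : ℤ, n - (h * a * m + r * d) = s * a :=
      ⟨n * u + (n * v / a) * d - h * m, by linear_combination (-n) * huv - d * hdiv⟩
    have hmZ : (m : ℤ) ≤ M := by exact_mod_cast hm
    have h1 : (m : ℤ) * (h * a) ≤ M * (h * a) := by gcongr
    have h2 : (r : ℤ) * d ≤ ((a : ℤ) - 1) * d := by gcongr; omega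
    have hs0 : 0 ≤ s := by
      by_contra! hneg
      nlinarith
    obtain ⟨x0, rfl⟩ := Int.eq_ofNat_of_zero_le hs0
    refine ⟨x0, x1, x2, x3, x4, ?_⟩
    rw [← hk, hmdef] at hs
    push_cast at hs ⊢
    linear_combination hs

theorem stmt_5 (b a h d : ℕ) (hb : 5 ≤ b) (hodd : Odd b)
    (ha : 0 < a) (hh : 0 < h) (hd : 0 < d) (hgcd : Nat.gcd a d = 1)
    (hhd : (2 * d) ⌈/⌉ ((b - 3) * (b + 1)) ≤ h)
    (ha' : (b - 3) * (b + 1) ^ 2 / 2 ≤ a) :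
    (a % (b + 1) ≤ 1 →
      IsGreatest {n : ℤ | ¬ ∃ x0 x1 x2 x3 x4 : ℕ,
          n = ((x0 * a + x1 * (h * a + d) + x2 * (h * a + 2 * d)
            + x3 * (h * a + b * d) + x4 * (h * a + (b + 1) * d) : ℕ) : ℤ)}
        (((a / (b + 1) : ℕ) : ℤ) * ((h : ℤ) * a + ((b : ℤ) + 1) * d)
          + (((a % (b + 1) : ℕ) : ℤ) - 1) * d - a)) ∧
    (2 ≤ a % (b + 1) →
      IsGreatest {n : ℤ | ¬ ∃ x0 x1 x2 x3 x4 : ℕ,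
          n = ((x0 * a + x1 * (h * a + d) + x2 * (h * a + 2 * d)
            + x3 * (h * a + b * d) + x4 * (h * a + (b + 1) * d) : ℕ) : ℤ)}
        (((a / (b + 1) : ℕ) : ℤ) * ((h : ℤ) * a + ((b : ℤ) + 1) * d)
          + (((a % (b + 1) : ℕ) : ℤ) - 1) * d + ((h : ℤ) - 1) * a)) := by
  have hsq : (b + 1) ^ 2 ≤ a := by
    refine le_trans ?_ ha'
    rw [Nat.le_div_iff_mul_le two_pos, mul_comm]
    exact Nat.mul_le_mul_right _ (by omega)
  have hq : b + 1 ≤ a / (b + 1) := by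
    rw [Nat.le_div_iff_mul_le (by omega)]
    nlinarith
  have hdm := Nat.div_add_mod a (b + 1)
  have hmod := Nat.mod_lt a (show 0 < b + 1 by omega)
  set q := a / (b + 1)
  set j := a % (b + 1)
  have hdmZ : ((b : ℤ) + 1) * q + j = a := by exact_mod_cast hdm
  constructor
  · intro hj
    convert isGreatest_nonrepresentable (b := b) (M := q) h ha (by omega) hgcd (by omega)
      (by nlinarith) ?_ using 1
    · linear_combination (d : ℤ) * hdmZ
    · intro m hm
      by_contra! hlt
      nlinarith
  · intro hj
    convert isGreatest_nonrepresentable (b := b) (M := q + 1) h ha (by omega) hgcd (by omega)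
      (by nlinarith) ?_ using 1
    · push_cast
      linear_combination (d : ℤ) * hdmZ
    · intro m hm
      by_contra! hlt
      nlinarith
end

section
/- Let b ≥ 4 be an even integer, and let a,h,d be positive integers with gcd(a,d)=1, h ≥ ⌈2d/((b−2)(b+1))⌉ and a ≥ (b−2)(b+1)²/2. Let A(a) = (a, ha+d, ha+2d, ha+bd, ha+(b+1)d) and write j = a mod (b+1). Then g(A(a)) = ⌊a/(b+1)⌋(ha+(b+1)d) + (j−1)d − a if j ∈ {0,1}, and g(A(a)) = ⌊a/(b+1)⌋(ha+(b+1)d) + (j−1)d + (h−1)a if j ∈ {2,3,...,b}. -/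
/-- Every `r ≤ T * (b + 1)` is a sum of at most `T` terms from `{1, 2, b, b + 1}`, once `b ≤ T`. -/
theorem exists_coins_of_le_mul {b r T : ℕ} (hT : b ≤ T) (hr : r ≤ T * (b + 1)) :
    ∃ x1 x2 x3 x4 : ℕ, x1 + 2 * x2 + b * x3 + (b + 1) * x4 = r ∧ x1 + x2 + x3 + x4 ≤ T := by
  obtain ⟨q, s, hs, rfl⟩ : ∃ q s, s < b + 1 ∧ r = (b + 1) * q + s :=
    ⟨r / (b + 1), r % (b + 1), Nat.mod_lt _ (by omega), (Nat.div_add_mod _ _).symm⟩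
  rcases Nat.eq_zero_or_pos s with rfl | hs0
  · exact ⟨0, 0, 0, q, by ring, by nlinarith⟩
  by_cases hq : b ≤ q + s
  · have hqT : q < T := by nlinarith
    obtain ⟨u, hu⟩ : ∃ u, q + s = b + u := ⟨q + s - b, by omega⟩
    obtain ⟨v, hv⟩ : ∃ v, b + 1 = s + v := ⟨b + 1 - s, by omega⟩
    refine ⟨0, 0, v, u, ?_, by omega⟩
    have hq' : q + 1 = u + v := by omega
    zify at *
    linear_combination (-(b : ℤ) - 1) * hq' + hv
  · exact ⟨s % 2, s / 2, 0, q, by have := Nat.mod_add_div s 2; linarith, by omega⟩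

/-- If `T` is the least integer with `a - 1 ≤ T * (b + 1)` and `b ≤ T`, then the Frobenius number
of `(a, h a + d, h a + 2 d, h a + b d, h a + (b + 1) d)` is `T h a + (a - 1) d - a`. -/
theorem isGreatest_not_representable {a b d h T : ℕ} (hb : 1 ≤ b) (ha : 0 < a)
    (hgcd : Nat.gcd a d = 1) (hT : b ≤ T) (haT : a ≤ T * (b + 1) + 1)
    (hTa : T * (b + 1) < a + b) :
    IsGreatest {n : ℤ | ¬ ∃ x0 x1 x2 x3 x4 : ℕ,
        n = ((x0 * a + x1 * (h * a + d) + x2 * (h * a + 2 * d)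
          + x3 * (h * a + b * d) + x4 * (h * a + (b + 1) * d) : ℕ) : ℤ)}
      ((T : ℤ) * h * a + ((a : ℤ) - 1) * d - a) := by
  have hcop : IsCoprime (a : ℤ) (d : ℤ) := Nat.isCoprime_iff_coprime.mpr hgcd
  have ha0 : (0 : ℤ) < a := by exact_mod_cast ha
  constructor
  · rintro ⟨x0, x1, x2, x3, x4, hx⟩
    obtain ⟨t, ht⟩ : ∃ t, t = x1 + x2 + x3 + x4 := ⟨_, rfl⟩
    obtain ⟨M, hM⟩ : ∃ M, M = x1 + 2 * x2 + b * x3 + (b + 1) * x4 := ⟨_, rfl⟩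
    have hMt : M ≤ t * (b + 1) := by subst hM ht; nlinarith
    have hx' : (T : ℤ) * h * a + ((a : ℤ) - 1) * d - a = x0 * a + t * h * a + M * d := by
      rw [hx, ht, hM]; push_cast; ring
    have hdvd : (a : ℤ) ∣ (M + 1 : ℕ) := by
      refine hcop.dvd_of_dvd_mul_right ⟨T * h + d - 1 - x0 - t * h, ?_⟩
      push_cast
      linear_combination -hx'
    have haM : a ≤ M + 1 := Nat.le_of_dvd (by omega) (Int.natCast_dvd_natCast.mp hdvd)
    have hTt : T ≤ t := by
      by_contra hlt
      have : (t + 1) * (b + 1) ≤ T * (b + 1) := Nat.mul_le_mul_right _ (by omega)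
      linarith
    have h1 : (T : ℤ) * (h * a) ≤ t * (h * a) := by
      exact_mod_cast Nat.mul_le_mul_right (h * a) hTt
    have h2 : ((a : ℤ) - 1) * d ≤ M * d :=
      mul_le_mul_of_nonneg_right (by omega) (by positivity)
    have h3 : (0 : ℤ) ≤ x0 * a := by positivity
    linarith
  · intro n hn
    by_contra! hlt
    apply hn
    obtain ⟨u, v, huv⟩ := hcop
    obtain ⟨r, hr⟩ := Int.eq_ofNat_of_zero_le (Int.emod_nonneg (n * v) ha0.ne')
    have hra : r < a := by have := Int.emod_lt_of_pos (n * v) ha0; omega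
    have hdiv := Int.emod_add_mul_ediv (n * v) a
    rw [hr] at hdiv
    obtain ⟨x1, x2, x3, x4, hsum, hcard⟩ :=
      exists_coins_of_le_mul (r := r) hT (by omega)
    obtain ⟨t, ht⟩ : ∃ t, t = x1 + x2 + x3 + x4 := ⟨_, rfl⟩
    rw [← ht] at hcard
    obtain ⟨k, hk⟩ : ∃ k : ℤ, n = k * a + t * h * a + r * d :=
      ⟨n * u + n * v / a * d - t * h, by linear_combination -n * huv - d * hdiv⟩
    have h1 : (t : ℤ) * (h * a) ≤ T * (h * a) := by
      exact_mod_cast Nat.mul_le_mul_right (h * a) hcard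
    have h2 : (r : ℤ) * d ≤ ((a : ℤ) - 1) * d :=
      mul_le_mul_of_nonneg_right (by omega) (by positivity)
    have hk0 : 0 ≤ k := by
      by_contra! hneg
      nlinarith
    lift k to ℕ using hk0
    refine ⟨k, x1, x2, x3, x4, ?_⟩
    rw [hk, ht, ← hsum]
    push_cast
    ring

theorem stmt_6 (b a h d : ℕ) (hb : 4 ≤ b) (heven : Even b)
    (ha : 0 < a) (hh : 0 < h) (hd : 0 < d) (hgcd : Nat.gcd a d = 1)
    (hhd : (2 * d) ⌈/⌉ ((b - 2) * (b + 1)) ≤ h)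
    (ha' : (b - 2) * (b + 1) ^ 2 / 2 ≤ a) :
    (a % (b + 1) ≤ 1 →
      IsGreatest {n : ℤ | ¬ ∃ x0 x1 x2 x3 x4 : ℕ,
          n = ((x0 * a + x1 * (h * a + d) + x2 * (h * a + 2 * d)
            + x3 * (h * a + b * d) + x4 * (h * a + (b + 1) * d) : ℕ) : ℤ)}
        (((a / (b + 1) : ℕ) : ℤ) * ((h : ℤ) * a + ((b : ℤ) + 1) * d)
          + (((a % (b + 1) : ℕ) : ℤ) - 1) * d - a)) ∧
    (2 ≤ a % (b + 1) →
      IsGreatest {n : ℤ | ¬ ∃ x0 x1 x2 x3 x4 : ℕ,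
          n = ((x0 * a + x1 * (h * a + d) + x2 * (h * a + 2 * d)
            + x3 * (h * a + b * d) + x4 * (h * a + (b + 1) * d) : ℕ) : ℤ)}
        (((a / (b + 1) : ℕ) : ℤ) * ((h : ℤ) * a + ((b : ℤ) + 1) * d)
          + (((a % (b + 1) : ℕ) : ℤ) - 1) * d + ((h : ℤ) - 1) * a)) := by
  have ha2 : (b + 1) ^ 2 ≤ a := by
    refine le_trans ?_ ha'
    rw [Nat.le_div_iff_mul_le (by norm_num), mul_comm]
    exact Nat.mul_le_mul_right _ (by omega)
  have hdm := Nat.div_add_mod a (b + 1)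
  have hlt := Nat.mod_lt a (show 0 < b + 1 by omega)
  generalize a / (b + 1) = q at *
  generalize a % (b + 1) = j at *
  have hq : b + 1 ≤ q := by
    by_contra! hqb
    nlinarith
  have hdm' : (a : ℤ) = (b + 1) * q + j := by exact_mod_cast hdm.symm
  constructor
  · intro hj
    convert isGreatest_not_representable (b := b) (h := h) (T := q) (by omega) ha hgcd (by omega)
      (by linarith) (by linarith) using 1
    linear_combination (-(d : ℤ)) * hdm'
  · intro hj
    convert isGreatest_not_representable (b := b) (h := h) (T := q + 1) (by omega) ha hgcd (by omega)
      (by linarith) (by linarith) using 1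
    push_cast
    linear_combination (-(d : ℤ)) * hdm'
end

section
/- Let b ≥ 4 be an even integer, and let a,h,d be positive integers with gcd(a,d)=1, h ≥ ⌈2d/(b−2)⌉ and a ≥ b(b−2). Let A(a) = (a, ha+d, ha+2d, ha+bd, ha+(b+1)d, ha+2bd) and write j = a mod 2b. Then: g(A(a)) = (⌊a/(2b)⌋ + b/2 − 1)ha + 2bd⌊a/(2b)⌋ − a − d if j ∈ {0,1,...,b−3}; g(A(a)) = (⌊a/(2b)⌋ + b/2 − 1)ha + 2bd⌊a/(2b)⌋ − a + bd − 3d if j = b−2; g(A(a)) = (⌊a/(2b)⌋ + b/2 − 1)ha + 2bd⌊a/(2b)⌋ − a + bd − 2d if j = b−1; g(A(a)) = (⌊a/(2b)⌋ + b/2)ha + 2bd⌊a/(2b)⌋ − a + bd − d if j ∈ {b,b+1,...,2b−2}; g(A(a)) = (⌊a/(2b)⌋ + b/2)ha + 2bd⌊a/(2b)⌋ − a + 2bd − 2d if j = 2b−1. -/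
/-- `M` is a sum of exactly `c` coins with denominations `1, 2, b, b + 1, 2 * b`. -/
def IsCoinSum (b c M : ℕ) : Prop :=
  ∃ x1 x2 x3 x4 x5 : ℕ, c = x1 + x2 + x3 + x4 + x5 ∧
    M = x1 + 2 * x2 + b * x3 + (b + 1) * x4 + 2 * b * x5

/-- Every amount `2 * b * q + s` with `s < 2 * b` is paid by `q` coins `2 * b`, at most one coin
`b` or `b + 1`, and small change. -/
lemma exists_isCoinSum {b s : ℕ} (q : ℕ) (hs : s < 2 * b) :
    ∃ c, IsCoinSum b c (2 * b * q + s) ∧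
      (s < b ∧ 2 * c ≤ 2 * q + s + 1 ∨ b ≤ s ∧ 2 * c + b ≤ 2 * q + 2 + s) := by
  rcases lt_trichotomy s b with h | h | h
  · refine ⟨_, ⟨s % 2, s / 2, 0, 0, q, rfl, ?_⟩, by omega⟩
    have := Nat.mod_add_div s 2
    linarith
  · refine ⟨_, ⟨0, 0, 1, 0, q, rfl, ?_⟩, by omega⟩
    subst h
    ring
  · obtain ⟨t, rfl⟩ : ∃ t, s = b + 1 + t := ⟨s - (b + 1), by omega⟩
    refine ⟨_, ⟨t % 2, t / 2, 0, 1, q, rfl, ?_⟩, by omega⟩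
    have := Nat.mod_add_div t 2
    linarith

lemma IsCoinSum.le_mul {b c M : ℕ} (hb : 1 ≤ b) (h : IsCoinSum b c M) : M ≤ 2 * b * c := by
  obtain ⟨x1, x2, x3, x4, x5, rfl, rfl⟩ := h
  nlinarith [Nat.mul_le_mul_right x1 hb, Nat.mul_le_mul_right x2 hb, Nat.mul_le_mul_right x4 hb,
    Nat.zero_le (b * x3)]

/-- If `M < b * (y + 1)`, then at least `(M - (b - 1) * y) / 2` coins are needed to pay `M`. -/
lemma IsCoinSum.le_two_mul {b c M y : ℕ} (hb : 1 ≤ b) (h : IsCoinSum b c M)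
    (hy : M < b * (y + 1)) : M + y ≤ 2 * c + b * y := by
  obtain ⟨x1, x2, x3, x4, x5, rfl, rfl⟩ := h
  have hle : x3 + x4 + 2 * x5 ≤ y := by
    refine Nat.le_of_lt_succ (Nat.lt_of_mul_lt_mul_left (a := b) (lt_of_le_of_lt ?_ hy))
    nlinarith
  obtain ⟨z, rfl⟩ := Nat.exists_eq_add_of_le hle
  nlinarith [Nat.mul_le_mul_right z hb]

/-- If `r` needs the largest weight `C * (h * a) + r * d` among all residues modulo `a`, then that
weight minus `a` is the Frobenius number. -/
lemma isGreatest_of_isCoinSum {b a h d r C : ℕ} (ha : 0 < a) (hgcd : Nat.gcd a d = 1) (hr : r < a)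
    (hmin : ∀ c m, IsCoinSum b c (r + m * a) → C ≤ c)
    (hmax : ∀ s < a, ∃ c, IsCoinSum b c s ∧ c * (h * a) + s * d ≤ C * (h * a) + r * d) :
    IsGreatest {n : ℤ | ¬ ∃ x0 x1 x2 x3 x4 x5 : ℕ,
          n = ((x0 * a + x1 * (h * a + d) + x2 * (h * a + 2 * d) + x3 * (h * a + b * d)
            + x4 * (h * a + (b + 1) * d) + x5 * (h * a + 2 * b * d) : ℕ) : ℤ)}
      ((C : ℤ) * (h * a) + r * d - a) := by
  have hcop : IsCoprime (a : ℤ) d := Nat.isCoprime_iff_coprime.2 hgcd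
  constructor
  · rintro ⟨x0, x1, x2, x3, x4, x5, hn⟩
    set M := x1 + 2 * x2 + b * x3 + (b + 1) * x4 + 2 * b * x5 with hM
    set c := x1 + x2 + x3 + x4 + x5 with hc
    have hn' : (C : ℤ) * (h * a) + r * d - a = x0 * a + c * (h * a) + M * d := by
      rw [hn, hM, hc]; push_cast; ring
    have hdvd : (a : ℤ) ∣ (M - r : ℤ) := by
      refine hcop.dvd_of_dvd_mul_right ⟨C * h - 1 - x0 - c * h, ?_⟩
      linear_combination -hn'
    obtain ⟨m, hm⟩ := hdvd
    have hm0 : 0 ≤ m := by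
      by_contra hneg
      have : (a : ℤ) * m ≤ a * (-1) := mul_le_mul_of_nonneg_left (by omega) (by omega)
      omega
    lift m to ℕ using hm0
    have hMr : M = r + m * a := by zify; linarith
    have hCc : C ≤ c := hmin c m ⟨x1, x2, x3, x4, x5, hc, by rw [← hMr]⟩
    have h1 : (C : ℤ) * (h * a) ≤ c * (h * a) := by exact_mod_cast Nat.mul_le_mul_right _ hCc
    have h2 : (r : ℤ) * d ≤ M * d := by
      exact_mod_cast Nat.mul_le_mul_right d (hMr ▸ Nat.le_add_right r (m * a))
    have h3 : (0 : ℤ) ≤ x0 * a := by positivity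
    omega
  · intro n hn
    by_contra hlt
    push Not at hlt
    apply hn
    obtain ⟨u, v, huv⟩ := hcop
    have ha0 : (0 : ℤ) < a := by exact_mod_cast ha
    obtain ⟨s, hs⟩ := Int.eq_ofNat_of_zero_le (Int.emod_nonneg (n * v) ha0.ne')
    have hsa : s < a := by
      have := Int.emod_lt_of_pos (n * v) ha0
      omega
    obtain ⟨c, ⟨x1, x2, x3, x4, x5, hc, hM⟩, hle⟩ := hmax s hsa
    have hdiv := Int.emod_add_mul_ediv (n * v) a
    rw [hs] at hdiv
    set e := n * v / a
    obtain ⟨t, ht⟩ : ∃ t : ℤ, n = t * a + c * (h * a) + s * d :=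
      ⟨n * u + e * d - c * h, by linear_combination (-n) * huv - d * hdiv⟩
    have hle' : (c : ℤ) * (h * a) + s * d ≤ C * (h * a) + r * d := by exact_mod_cast hle
    have ht0 : 0 ≤ t := by
      by_contra hneg
      have : t * a ≤ (-1) * a := mul_le_mul_of_nonneg_right (by omega) ha0.le
      linarith
    lift t to ℕ using ht0
    refine ⟨t, x1, x2, x3, x4, x5, ?_⟩
    rw [ht, hc, hM]
    push_cast
    ring

/-- Version of `isGreatest_of_isCoinSum` for `2 * b * d ≤ h * a`, where the number of coins
dominates the weight and amounts from `r + a` on need many coins for size reasons. -/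
lemma isGreatest_of_bounds {b a h d r C y : ℕ} (hb : 1 ≤ b) (ha : 0 < a)
    (hgcd : Nat.gcd a d = 1) (hr : r < a) (hbig : 2 * b * d ≤ h * a) (hra : a ≤ r + 2 * b)
    (hy : r < b * (y + 1)) (hCy : 2 * C + b * y ≤ r + y + 1)
    (hCa : 2 * b * C < r + a + 2 * b)
    (hmax : ∀ q s, s < 2 * b → 2 * b * q + s < a →
      (∀ c, (s < b ∧ 2 * c ≤ 2 * q + s + 1 ∨ b ≤ s ∧ 2 * c + b ≤ 2 * q + 2 + s) →
        c < C ∨ c ≤ C ∧ 2 * b * q + s ≤ r)) :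
    IsGreatest {n : ℤ | ¬ ∃ x0 x1 x2 x3 x4 x5 : ℕ,
          n = ((x0 * a + x1 * (h * a + d) + x2 * (h * a + 2 * d) + x3 * (h * a + b * d)
            + x4 * (h * a + (b + 1) * d) + x5 * (h * a + 2 * b * d) : ℕ) : ℤ)}
      ((C : ℤ) * (h * a) + r * d - a) := by
  refine isGreatest_of_isCoinSum ha hgcd hr (fun c m hc => ?_) (fun s hs => ?_)
  · rcases Nat.eq_zero_or_pos m with rfl | hm
    · rw [zero_mul, add_zero] at hc
      have := hc.le_two_mul hb hy
      omega
    · have h1 := hc.le_mul hb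
      have h2 : 1 * a ≤ m * a := Nat.mul_le_mul_right a hm
      have h3 : 2 * b * C < 2 * b * (c + 1) := by linarith
      exact Nat.le_of_lt_succ (Nat.lt_of_mul_lt_mul_left h3)
  · have hdiv := Nat.div_add_mod s (2 * b)
    have hmod := Nat.mod_lt s (show 0 < 2 * b by omega)
    obtain ⟨c, hc, hbd⟩ := exists_isCoinSum (s / (2 * b)) hmod
    have hcases := hmax _ _ hmod (by omega) c hbd
    rw [hdiv] at hc hcases
    refine ⟨c, hc, ?_⟩
    rcases hcases with h1 | ⟨h1, h2⟩
    · have h3 : (c + 1) * (h * a) ≤ C * (h * a) := Nat.mul_le_mul_right _ h1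
      have h4 : s * d ≤ (r + 2 * b) * d := Nat.mul_le_mul_right _ (by omega)
      linarith
    · exact Nat.add_le_add (Nat.mul_le_mul_right _ h1) (Nat.mul_le_mul_right _ h2)

theorem stmt_10 (b a h d : ℕ) (hb : 4 ≤ b) (heven : Even b)
    (ha : 0 < a) (hh : 0 < h) (hd : 0 < d) (hgcd : Nat.gcd a d = 1)
    (hhd : (2 * d) ⌈/⌉ (b - 2) ≤ h) (ha' : b * (b - 2) ≤ a) :
    (a % (2 * b) ≤ b - 3 →
      IsGreatest {n : ℤ | ¬ ∃ x0 x1 x2 x3 x4 x5 : ℕ,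
          n = ((x0 * a + x1 * (h * a + d) + x2 * (h * a + 2 * d) + x3 * (h * a + b * d)
            + x4 * (h * a + (b + 1) * d) + x5 * (h * a + 2 * b * d) : ℕ) : ℤ)}
        ((((a / (2 * b) : ℕ) : ℤ) + ((b / 2 : ℕ) : ℤ) - 1) * ((h : ℤ) * a)
          + 2 * b * d * ((a / (2 * b) : ℕ) : ℤ) - a - d)) ∧
    (a % (2 * b) = b - 2 →
      IsGreatest {n : ℤ | ¬ ∃ x0 x1 x2 x3 x4 x5 : ℕ,
          n = ((x0 * a + x1 * (h * a + d) + x2 * (h * a + 2 * d) + x3 * (h * a + b * d)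
            + x4 * (h * a + (b + 1) * d) + x5 * (h * a + 2 * b * d) : ℕ) : ℤ)}
        ((((a / (2 * b) : ℕ) : ℤ) + ((b / 2 : ℕ) : ℤ) - 1) * ((h : ℤ) * a)
          + 2 * b * d * ((a / (2 * b) : ℕ) : ℤ) - a + (b : ℤ) * d - 3 * d)) ∧
    (a % (2 * b) = b - 1 →
      IsGreatest {n : ℤ | ¬ ∃ x0 x1 x2 x3 x4 x5 : ℕ,
          n = ((x0 * a + x1 * (h * a + d) + x2 * (h * a + 2 * d) + x3 * (h * a + b * d)
            + x4 * (h * a + (b + 1) * d) + x5 * (h * a + 2 * b * d) : ℕ) : ℤ)}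
        ((((a / (2 * b) : ℕ) : ℤ) + ((b / 2 : ℕ) : ℤ) - 1) * ((h : ℤ) * a)
          + 2 * b * d * ((a / (2 * b) : ℕ) : ℤ) - a + (b : ℤ) * d - 2 * d)) ∧
    (b ≤ a % (2 * b) ∧ a % (2 * b) ≤ 2 * b - 2 →
      IsGreatest {n : ℤ | ¬ ∃ x0 x1 x2 x3 x4 x5 : ℕ,
          n = ((x0 * a + x1 * (h * a + d) + x2 * (h * a + 2 * d) + x3 * (h * a + b * d)
            + x4 * (h * a + (b + 1) * d) + x5 * (h * a + 2 * b * d) : ℕ) : ℤ)}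
        ((((a / (2 * b) : ℕ) : ℤ) + ((b / 2 : ℕ) : ℤ)) * ((h : ℤ) * a)
          + 2 * b * d * ((a / (2 * b) : ℕ) : ℤ) - a + (b : ℤ) * d - d)) ∧
    (a % (2 * b) = 2 * b - 1 →
      IsGreatest {n : ℤ | ¬ ∃ x0 x1 x2 x3 x4 x5 : ℕ,
          n = ((x0 * a + x1 * (h * a + d) + x2 * (h * a + 2 * d) + x3 * (h * a + b * d)
            + x4 * (h * a + (b + 1) * d) + x5 * (h * a + 2 * b * d) : ℕ) : ℤ)}
        ((((a / (2 * b) : ℕ) : ℤ) + ((b / 2 : ℕ) : ℤ)) * ((h : ℤ) * a)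
          + 2 * b * d * ((a / (2 * b) : ℕ) : ℤ) - a + 2 * (b : ℤ) * d - 2 * d)) := by
  obtain ⟨k, rfl⟩ := heven
  have hbig : 2 * (k + k) * d ≤ h * a := by
    have h1 : 2 * d ≤ (k + k - 2) * h := (ceilDiv_le_iff_le_mul (by omega)).1 hhd
    calc 2 * (k + k) * d = (k + k) * (2 * d) := by ring
      _ ≤ (k + k) * ((k + k - 2) * h) := Nat.mul_le_mul_left _ h1
      _ = h * ((k + k) * (k + k - 2)) := by ring
      _ ≤ h * a := Nat.mul_le_mul_left _ ha'
  have hQ : k ≤ a / (2 * (k + k)) + 1 := by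
    have : k - 1 ≤ a / (2 * (k + k)) := by
      rw [Nat.le_div_iff_mul_le (by omega)]
      refine le_trans (le_of_eq ?_) ha'
      rw [show k + k - 2 = 2 * (k - 1) by omega]
      ring
    omega
  have hdiv := Nat.div_add_mod a (2 * (k + k))
  have hk : (k + k) / 2 = k := by omega
  rw [hk]
  generalize a % (2 * (k + k)) = j at *
  generalize a / (2 * (k + k)) = Q at *
  obtain ⟨P, hP⟩ : ∃ P, P = k * Q := ⟨_, rfl⟩
  have hkk : k * k ≤ P + k := by rw [hP]; nlinarith
  have hQ1 : 1 ≤ Q := by omega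
  have hkP : k ≤ P := by rw [hP]; exact Nat.le_mul_of_pos_right k hQ1
  have haP : a = 4 * P + j := by rw [hP, ← hdiv]; ring
  have hquot : ∀ q s, 2 * (k + k) * q + s < a → j < 2 * (k + k) →
      q = Q ∧ 2 * (k + k) * q = 4 * P ∨ q + 1 ≤ Q ∧ 2 * (k + k) * q + 4 * k ≤ 4 * P := by
    intro q s hqs hj
    rcases lt_trichotomy q Q with hlt | rfl | hgt
    · right
      refine ⟨hlt, ?_⟩
      have := Nat.mul_le_mul_left k hlt
      rw [hP]; linarith
    · left
      exact ⟨rfl, by rw [hP]; ring⟩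
    · have := Nat.mul_le_mul_left k (Nat.succ_le_of_lt hgt)
      rw [Nat.mul_succ] at this
      nlinarith
  refine ⟨fun hj => ?_, fun hj => ?_, fun hj => ?_, fun hj => ?_, fun hj => ?_⟩
  · obtain ⟨C, hC⟩ : ∃ C, C = Q + k - 1 := ⟨_, rfl⟩
    obtain ⟨r, hr⟩ : ∃ r, r = 4 * P - 1 := ⟨_, rfl⟩
    have hy : (k + k) * (2 * Q - 1) + 2 * k = 4 * P := by
      obtain ⟨l, rfl⟩ := Nat.exists_eq_add_of_le hQ1
      rw [hP, show 2 * (1 + l) - 1 = 2 * l + 1 by omega]; ring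
    have hCk : 2 * (k + k) * C + 4 * k = 4 * P + 4 * (k * k) := by
      obtain ⟨l, rfl⟩ := Nat.exists_eq_add_of_le hQ1
      rw [hC, hP, show 1 + l + k - 1 = l + k by omega]; ring
    have key := isGreatest_of_bounds (b := k + k) (r := r) (C := C) (y := 2 * Q - 1) (by omega) ha hgcd
      (by omega) hbig (by omega) (by rw [Nat.mul_succ]; omega) (by omega) (by omega)
      (fun q s hs hqs c hc => by have := hquot q s hqs (by omega); omega)
    convert key using 1
    have hC' : (C : ℤ) = (Q : ℤ) + k - 1 := by omega
    have hr' : (r : ℤ) = 4 * (k * Q : ℤ) - 1 := by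
      rw [show (k * Q : ℤ) = (P : ℤ) by rw [hP]; push_cast; ring]; omega
    rw [hC', hr']
    push_cast
    ring
  · obtain ⟨C, hC⟩ : ∃ C, C = Q + k - 1 := ⟨_, rfl⟩
    obtain ⟨r, hr⟩ : ∃ r, r = 4 * P + 2 * k - 3 := ⟨_, rfl⟩
    have hy : (k + k) * (2 * Q) = 4 * P := by rw [hP]; ring
    have hCk : 2 * (k + k) * C + 4 * k = 4 * P + 4 * (k * k) := by
      obtain ⟨l, rfl⟩ := Nat.exists_eq_add_of_le hQ1
      rw [hC, hP, show 1 + l + k - 1 = l + k by omega]; ring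
    have key := isGreatest_of_bounds (b := k + k) (r := r) (C := C) (y := 2 * Q) (by omega) ha hgcd
      (by omega) hbig (by omega) (by rw [Nat.mul_succ]; omega) (by omega) (by omega)
      (fun q s hs hqs c hc => by have := hquot q s hqs (by omega); omega)
    convert key using 1
    have hC' : (C : ℤ) = (Q : ℤ) + k - 1 := by omega
    have hr' : (r : ℤ) = 4 * (k * Q : ℤ) + 2 * k - 3 := by
      rw [show (k * Q : ℤ) = (P : ℤ) by rw [hP]; push_cast; ring]; omega
    rw [hC', hr']
    push_cast
    ring
  · obtain ⟨C, hC⟩ : ∃ C, C = Q + k - 1 := ⟨_, rfl⟩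
    obtain ⟨r, hr⟩ : ∃ r, r = 4 * P + 2 * k - 2 := ⟨_, rfl⟩
    have hy : (k + k) * (2 * Q) = 4 * P := by rw [hP]; ring
    have hCk : 2 * (k + k) * C + 4 * k = 4 * P + 4 * (k * k) := by
      obtain ⟨l, rfl⟩ := Nat.exists_eq_add_of_le hQ1
      rw [hC, hP, show 1 + l + k - 1 = l + k by omega]; ring
    have key := isGreatest_of_bounds (b := k + k) (r := r) (C := C) (y := 2 * Q) (by omega) ha hgcd
      (by omega) hbig (by omega) (by rw [Nat.mul_succ]; omega) (by omega) (by omega)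
      (fun q s hs hqs c hc => by have := hquot q s hqs (by omega); omega)
    convert key using 1
    have hC' : (C : ℤ) = (Q : ℤ) + k - 1 := by omega
    have hr' : (r : ℤ) = 4 * (k * Q : ℤ) + 2 * k - 2 := by
      rw [show (k * Q : ℤ) = (P : ℤ) by rw [hP]; push_cast; ring]; omega
    rw [hC', hr']
    push_cast
    ring
  · obtain ⟨C, hC⟩ : ∃ C, C = Q + k := ⟨_, rfl⟩
    obtain ⟨r, hr⟩ : ∃ r, r = 4 * P + 2 * k - 1 := ⟨_, rfl⟩
    have hy : (k + k) * (2 * Q) = 4 * P := by rw [hP]; ring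
    have hCk : 2 * (k + k) * C = 4 * P + 4 * (k * k) := by
      rw [hC, hP]; ring
    have key := isGreatest_of_bounds (b := k + k) (r := r) (C := C) (y := 2 * Q) (by omega) ha hgcd
      (by omega) hbig (by omega) (by rw [Nat.mul_succ]; omega) (by omega) (by omega)
      (fun q s hs hqs c hc => by have := hquot q s hqs (by omega); omega)
    convert key using 1
    have hC' : (C : ℤ) = (Q : ℤ) + k := by omega
    have hr' : (r : ℤ) = 4 * (k * Q : ℤ) + 2 * k - 1 := by
      rw [show (k * Q : ℤ) = (P : ℤ) by rw [hP]; push_cast; ring]; omega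
    rw [hC', hr']
    push_cast
    ring
  · obtain ⟨C, hC⟩ : ∃ C, C = Q + k := ⟨_, rfl⟩
    obtain ⟨r, hr⟩ : ∃ r, r = 4 * P + 4 * k - 2 := ⟨_, rfl⟩
    have hy : (k + k) * (2 * Q + 1) = 4 * P + 2 * k := by rw [hP]; ring
    have hCk : 2 * (k + k) * C = 4 * P + 4 * (k * k) := by
      rw [hC, hP]; ring
    have key := isGreatest_of_bounds (b := k + k) (r := r) (C := C) (y := 2 * Q + 1) (by omega) ha hgcd
      (by omega) hbig (by omega) (by rw [Nat.mul_succ]; omega) (by omega) (by omega)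
      (fun q s hs hqs c hc => by have := hquot q s hqs (by omega); omega)
    convert key using 1
    have hC' : (C : ℤ) = (Q : ℤ) + k := by omega
    have hr' : (r : ℤ) = 4 * (k * Q : ℤ) + 4 * k - 2 := by
      rw [show (k * Q : ℤ) = (P : ℤ) by rw [hP]; push_cast; ring]; omega
    rw [hC', hr']
    push_cast
    ring
end

section
/- Let b ≥ 5 be an odd integer, and let a,h,d be positive integers with gcd(a,d)=1, h ≥ ⌈2d/(b−1)⌉ and a ≥ b(b−1). Let A(a) = (a, ha+d, ha+2d, ha+bd, ha+(b+1)d, ha+2bd) and write j = a mod 2b. Then: g(A(a)) = (⌊a/(2b)⌋ + (b−1)/2)ha + 2bd⌊a/(2b)⌋ − a − d if j ∈ {0,1,...,b−2}; g(A(a)) = (⌊a/(2b)⌋ + (b−1)/2)ha + 2bd⌊a/(2b)⌋ − a + bd − 2d if j = b−1; g(A(a)) = (⌊a/(2b)⌋ + (b−1)/2)ha + 2bd⌊a/(2b)⌋ − a + bd − d if j ∈ {b,b+1,...,2b−3}; g(A(a)) = (⌊a/(2b)⌋ + (b−1)/2)ha + 2bd⌊a/(2b)⌋ − a + 2bd −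 3d if j = 2b−2; g(A(a)) = (⌊a/(2b)⌋ + (b−1)/2)ha + 2bd⌊a/(2b)⌋ − a + 2bd − 2d if j = 2b−1. -/
/-- The least number of parts from `1, 2, b, b + 1, 2 * b` (for odd `b ≥ 5`) with sum `m`. -/
def partCount (b m : ℕ) : ℕ :=
  m / (2 * b) + if m % (2 * b) < b then (m % (2 * b) + 1) / 2 else (m % (2 * b) - b + 2) / 2

theorem partCount_mul_add {b u s : ℕ} (hs : s < 2 * b) :
    partCount b (2 * b * u + s) = u + if s < b then (s + 1) / 2 else (s - b + 2) / 2 := by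
  have hdiv : (2 * b * u + s) / (2 * b) = u := by
    rw [Nat.mul_add_div (by omega), Nat.div_eq_of_lt hs, add_zero]
  have hmod : (2 * b * u + s) % (2 * b) = s := by
    rw [Nat.mul_add_mod, Nat.mod_eq_of_lt hs]
  rw [partCount, hdiv, hmod]

theorem partCount_add_part_le {b w : ℕ} (hb : 5 ≤ b) (hodd : Odd b)
    (hw : w = 1 ∨ w = 2 ∨ w = b ∨ w = b + 1 ∨ w = 2 * b) (m : ℕ) :
    partCount b (m + w) ≤ partCount b m + 1 := by
  obtain ⟨p, hp⟩ := hodd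
  obtain ⟨u, s, hs, rfl⟩ : ∃ u s, s < 2 * b ∧ m = 2 * b * u + s :=
    ⟨m / (2 * b), m % (2 * b), Nat.mod_lt _ (by omega), (Nat.div_add_mod _ _).symm⟩
  rw [partCount_mul_add hs]
  by_cases hsw : s + w < 2 * b
  · rw [add_assoc, partCount_mul_add hsw]
    split_ifs <;> omega
  · have hcarry : 2 * b * u + s + w = 2 * b * (u + 1) + (s + w - 2 * b) := by
      rw [mul_add]; omega
    rw [hcarry, partCount_mul_add (by omega)]
    split_ifs <;> omega

theorem partCount_add_mul_part_le {b w : ℕ} (hb : 5 ≤ b) (hodd : Odd b)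
    (hw : w = 1 ∨ w = 2 ∨ w = b ∨ w = b + 1 ∨ w = 2 * b) (m x : ℕ) :
    partCount b (m + x * w) ≤ partCount b m + x := by
  induction x with
  | zero => simp
  | succ x ih =>
    have := partCount_add_part_le hb hodd hw (m + x * w)
    rw [show m + (x + 1) * w = m + x * w + w by ring]
    omega

theorem partCount_le {b : ℕ} (hb : 5 ≤ b) (hodd : Odd b) (x1 x2 x3 x4 x5 : ℕ) :
    partCount b (x1 + x2 * 2 + x3 * b + x4 * (b + 1) + x5 * (2 * b)) ≤
      x1 + x2 + x3 + x4 + x5 := by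
  have h0 : partCount b 0 = 0 := by simp [partCount]; omega
  have h1 := partCount_add_mul_part_le hb hodd (w := 1) (by simp) 0 x1
  have h2 := partCount_add_mul_part_le hb hodd (w := 2) (by simp) x1 x2
  have h3 := partCount_add_mul_part_le hb hodd (w := b) (by simp) (x1 + x2 * 2) x3
  have h4 := partCount_add_mul_part_le hb hodd (w := b + 1) (by simp) (x1 + x2 * 2 + x3 * b) x4
  have h5 := partCount_add_mul_part_le hb hodd (w := 2 * b) (by simp)
    (x1 + x2 * 2 + x3 * b + x4 * (b + 1)) x5
  rw [zero_add, mul_one] at h1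
  omega

theorem exists_parts_of_partCount {b : ℕ} (hb : 0 < b) (m : ℕ) :
    ∃ x1 x2 x3 x4 x5 : ℕ, x1 + x2 * 2 + x3 * b + x4 * (b + 1) + x5 * (2 * b) = m ∧
      x1 + x2 + x3 + x4 + x5 = partCount b m := by
  obtain ⟨u, s, hs, rfl⟩ : ∃ u s, s < 2 * b ∧ m = 2 * b * u + s :=
    ⟨m / (2 * b), m % (2 * b), Nat.mod_lt _ (by omega), (Nat.div_add_mod _ _).symm⟩
  rw [partCount_mul_add hs, mul_comm (2 * b) u]
  by_cases hsb : s < b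
  · exact ⟨s % 2, s / 2, 0, 0, u, by omega, by rw [if_pos hsb]; omega⟩
  · rw [if_neg hsb]
    rcases Nat.mod_two_eq_zero_or_one (s - b) with h | h
    · exact ⟨0, (s - b) / 2, 1, 0, u, by omega, by omega⟩
    · exact ⟨0, (s - b) / 2, 0, 1, u, by omega, by omega⟩

theorem not_representable_of_partCount_eq {b a h d q p M : ℕ} (hb : 5 ≤ b) (hodd : Odd b)
    (hgcd : Nat.gcd a d = 1) (hpq : p ≤ q) (hMa : M < a)
    (hM : 2 * b * (2 * q) ≤ M + a + 1) (hcount : partCount b M = q + p) :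
    ¬ ∃ x0 x1 x2 x3 x4 x5 : ℕ,
        ((q : ℤ) + p) * ((h : ℤ) * a) + (M : ℤ) * d - a =
          ((x0 * a + x1 * (h * a + d) + x2 * (h * a + 2 * d) + x3 * (h * a + b * d)
          + x4 * (h * a + (b + 1) * d) + x5 * (h * a + 2 * b * d) : ℕ) : ℤ) := by
  rintro ⟨x0, x1, x2, x3, x4, x5, hx⟩
  obtain ⟨m, hm⟩ : ∃ m, m = x1 + x2 * 2 + x3 * b + x4 * (b + 1) + x5 * (2 * b) := ⟨_, rfl⟩
  obtain ⟨k, hk⟩ : ∃ k, k = x1 + x2 + x3 + x4 + x5 := ⟨_, rfl⟩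
  have hmk : partCount b m ≤ k := by rw [hm, hk]; exact partCount_le hb hodd ..
  have hm_le : m ≤ 2 * b * k := by
    subst hm hk
    nlinarith [Nat.mul_le_mul_left x1 (show 1 ≤ 2 * b by omega),
      Nat.mul_le_mul_left x2 (show 2 ≤ 2 * b by omega),
      Nat.mul_le_mul_left x3 (show b ≤ 2 * b by omega),
      Nat.mul_le_mul_left x4 (show b + 1 ≤ 2 * b by omega)]
  have heq : (q + p) * (h * a) + M * d = (x0 + 1) * a + k * (h * a) + m * d := by
    subst hm hk
    zify
    push_cast at hx
    linear_combination hx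
  have hmod : m ≡ M [MOD a] := by
    have hmul : m * d ≡ M * d [MOD a] := by
      have hl : (q + p) * (h * a) + M * d ≡ M * d [MOD a] := by
        rw [show (q + p) * (h * a) + M * d = M * d + a * ((q + p) * h) by ring]
        exact Nat.add_mul_mod_self_left _ _ _
      have hr : (x0 + 1) * a + k * (h * a) + m * d ≡ m * d [MOD a] := by
        rw [show (x0 + 1) * a + k * (h * a) + m * d = m * d + a * (x0 + 1 + k * h) by ring]
        exact Nat.add_mul_mod_self_left _ _ _
      rw [heq] at hl
      exact hr.symm.trans hl
    exact Nat.ModEq.cancel_right_of_coprime hgcd hmul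
  have hmM : m = M + a * (m / a) := by
    have hmodeq : m % a = M := by rw [hmod, Nat.mod_eq_of_lt hMa]
    have := Nat.mod_add_div m a
    omega
  have hqk : q + p ≤ k := by
    rcases Nat.eq_zero_or_pos (m / a) with h0 | hpos
    · rw [h0, mul_zero, add_zero] at hmM
      rw [← hcount, ← hmM]
      exact hmk
    · have hle_m : M + a ≤ m := by nlinarith
      by_contra! hlt
      nlinarith [Nat.mul_le_mul_left (2 * b) (show k + 1 ≤ 2 * q by omega)]
  have hMm : M * d ≤ m * d := Nat.mul_le_mul_right d (by omega)
  have hkh := Nat.mul_le_mul_right (h * a) hqk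
  nlinarith

theorem representable_of_partCount_le {b a h d q p M : ℕ} (hb : 0 < b)
    (ha : 0 < a) (hgcd : Nat.gcd a d = 1) (hgap : 2 * b * d ≤ h * a)
    (hle : ∀ r < a, r ≤ M ∧ partCount b r ≤ q + p ∨
      r ≤ M + 2 * b ∧ partCount b r + 1 ≤ q + p) {n : ℤ}
    (hlt : ((q : ℤ) + p) * ((h : ℤ) * a) + (M : ℤ) * d - a < n) :
    ∃ x0 x1 x2 x3 x4 x5 : ℕ,
        n = ((x0 * a + x1 * (h * a + d) + x2 * (h * a + 2 * d) + x3 * (h * a + b * d)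
          + x4 * (h * a + (b + 1) * d) + x5 * (h * a + 2 * b * d) : ℕ) : ℤ) := by
  have hcop : IsCoprime (d : ℤ) (a : ℤ) :=
    Nat.isCoprime_iff_coprime.mpr (Nat.Coprime.symm hgcd)
  obtain ⟨α, β, hαβ⟩ := hcop
  obtain ⟨r, hr⟩ := Int.eq_ofNat_of_zero_le (Int.emod_nonneg (n * α) (b := (a : ℤ)) (by omega))
  have hra : r < a := by
    have := Int.emod_lt_of_pos (n * α) (b := (a : ℤ)) (by omega)
    omega
  obtain ⟨x1, x2, x3, x4, x5, hsum, hcnt⟩ := exists_parts_of_partCount hb r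
  have hbound : (partCount b r : ℤ) * (h * a) + r * d ≤ (q + p) * (h * a) + M * d := by
    norm_cast
    rcases hle r hra with ⟨hrM, hc⟩ | ⟨hrM, hc⟩
    · exact add_le_add (Nat.mul_le_mul_right _ hc) (Nat.mul_le_mul_right _ hrM)
    · nlinarith [Nat.mul_le_mul_right (h * a) hc, Nat.mul_le_mul_right d hrM]
  have hdiv := Int.emod_add_mul_ediv (n * α) a
  rw [hr] at hdiv
  obtain ⟨t, ht⟩ : ∃ t : ℤ, n = partCount b r * (h * a) + r * d + t * a :=
    ⟨n * β + (n * α / a) * d - partCount b r * h, by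
      linear_combination (-n) * hαβ - (d : ℤ) * hdiv⟩
  have ht0 : 0 ≤ t := by
    have : 0 < (t + 1) * (a : ℤ) := by linarith
    have := pos_of_mul_pos_left this (by omega)
    omega
  obtain ⟨x0, rfl⟩ := Int.eq_ofNat_of_zero_le ht0
  refine ⟨x0, x1, x2, x3, x4, x5, ?_⟩
  rw [ht, ← hcnt, ← hsum]
  push_cast
  ring

theorem stmt_11 (b a h d : ℕ) (hb : 5 ≤ b) (hodd : Odd b)
    (ha : 0 < a) (hh : 0 < h) (hd : 0 < d) (hgcd : Nat.gcd a d = 1)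
    (hhd : (2 * d) ⌈/⌉ (b - 1) ≤ h) (ha' : b * (b - 1) ≤ a) :
    (a % (2 * b) ≤ b - 2 →
      IsGreatest {n : ℤ | ¬ ∃ x0 x1 x2 x3 x4 x5 : ℕ,
          n = ((x0 * a + x1 * (h * a + d) + x2 * (h * a + 2 * d) + x3 * (h * a + b * d)
            + x4 * (h * a + (b + 1) * d) + x5 * (h * a + 2 * b * d) : ℕ) : ℤ)}
        ((((a / (2 * b) : ℕ) : ℤ) + (((b - 1) / 2 : ℕ) : ℤ)) * ((h : ℤ) * a)
          + 2 * b * d * ((a / (2 * b) : ℕ) : ℤ) - a - d)) ∧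
    (a % (2 * b) = b - 1 →
      IsGreatest {n : ℤ | ¬ ∃ x0 x1 x2 x3 x4 x5 : ℕ,
          n = ((x0 * a + x1 * (h * a + d) + x2 * (h * a + 2 * d) + x3 * (h * a + b * d)
            + x4 * (h * a + (b + 1) * d) + x5 * (h * a + 2 * b * d) : ℕ) : ℤ)}
        ((((a / (2 * b) : ℕ) : ℤ) + (((b - 1) / 2 : ℕ) : ℤ)) * ((h : ℤ) * a)
          + 2 * b * d * ((a / (2 * b) : ℕ) : ℤ) - a + (b : ℤ) * d - 2 * d)) ∧
    (b ≤ a % (2 * b) ∧ a % (2 * b) ≤ 2 * b - 3 →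
      IsGreatest {n : ℤ | ¬ ∃ x0 x1 x2 x3 x4 x5 : ℕ,
          n = ((x0 * a + x1 * (h * a + d) + x2 * (h * a + 2 * d) + x3 * (h * a + b * d)
            + x4 * (h * a + (b + 1) * d) + x5 * (h * a + 2 * b * d) : ℕ) : ℤ)}
        ((((a / (2 * b) : ℕ) : ℤ) + (((b - 1) / 2 : ℕ) : ℤ)) * ((h : ℤ) * a)
          + 2 * b * d * ((a / (2 * b) : ℕ) : ℤ) - a + (b : ℤ) * d - d)) ∧
    (a % (2 * b) = 2 * b - 2 →
      IsGreatest {n : ℤ | ¬ ∃ x0 x1 x2 x3 x4 x5 : ℕ,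
          n = ((x0 * a + x1 * (h * a + d) + x2 * (h * a + 2 * d) + x3 * (h * a + b * d)
            + x4 * (h * a + (b + 1) * d) + x5 * (h * a + 2 * b * d) : ℕ) : ℤ)}
        ((((a / (2 * b) : ℕ) : ℤ) + (((b - 1) / 2 : ℕ) : ℤ)) * ((h : ℤ) * a)
          + 2 * b * d * ((a / (2 * b) : ℕ) : ℤ) - a + 2 * (b : ℤ) * d - 3 * d)) ∧
    (a % (2 * b) = 2 * b - 1 →
      IsGreatest {n : ℤ | ¬ ∃ x0 x1 x2 x3 x4 x5 : ℕ,
          n = ((x0 * a + x1 * (h * a + d) + x2 * (h * a + 2 * d) + x3 * (h * a + b * d)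
            + x4 * (h * a + (b + 1) * d) + x5 * (h * a + 2 * b * d) : ℕ) : ℤ)}
        ((((a / (2 * b) : ℕ) : ℤ) + (((b - 1) / 2 : ℕ) : ℤ)) * ((h : ℤ) * a)
          + 2 * b * d * ((a / (2 * b) : ℕ) : ℤ) - a + 2 * (b : ℤ) * d - 2 * d)) := by
  obtain ⟨p, hp⟩ := id hodd
  have hp2 : 2 ≤ p := by omega
  obtain ⟨q, hq⟩ : ∃ q, q = a / (2 * b) := ⟨_, rfl⟩
  obtain ⟨j, hj⟩ : ∃ j, j = a % (2 * b) := ⟨_, rfl⟩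
  have hjb : j < 2 * b := by rw [hj]; exact Nat.mod_lt _ (by omega)
  have haq : 2 * b * q + j = a := by rw [hq, hj]; exact Nat.div_add_mod _ _
  have hpq : p ≤ q := by
    rw [hq, Nat.le_div_iff_mul_le (by omega)]
    calc p * (2 * b) = b * (b - 1) := by rw [show b - 1 = 2 * p by omega]; ring
      _ ≤ a := ha'
  have hgap : 2 * b * d ≤ h * a := by
    rw [ceilDiv_le_iff_le_mul (by omega)] at hhd
    calc 2 * b * d = b * (2 * d) := by ring
      _ ≤ b * ((b - 1) * h) := Nat.mul_le_mul_left b hhd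
      _ = h * (b * (b - 1)) := by ring
      _ ≤ h * a := Nat.mul_le_mul_left h ha'
  have hbq : 2 * b * (2 * q) = 2 * (2 * b * q) := by ring
  have hbq1 : 2 * b * q = 2 * b * (q - 1) + 2 * b := by
    rw [← Nat.mul_succ]; congr 1; omega
  have hlow : ∀ {r}, r < 2 * b * q → partCount b r ≤ q + p := by
    intro r hr
    have hu : r / (2 * b) < q := Nat.div_lt_of_lt_mul hr
    have hs := Nat.mod_lt r (show 2 * b > 0 by omega)
    rw [partCount]
    split_ifs <;> omega
  have hhigh : ∀ {r}, 2 * b * q ≤ r → r < a → ∃ s < j, r = 2 * b * q + s ∧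
      partCount b r = q + if s < b then (s + 1) / 2 else (s - b + 2) / 2 := by
    intro r hr hra
    refine ⟨r - 2 * b * q, by omega, by omega, ?_⟩
    rw [← partCount_mul_add (show r - 2 * b * q < 2 * b by omega)]
    congr 1
    omega
  have key : ∀ M : ℕ, M < a → 2 * b * q ≤ M + 1 → partCount b M = q + p →
      (∀ s < j, 2 * b * q + s ≤ M ∧ (if s < b then (s + 1) / 2 else (s - b + 2) / 2) ≤ p ∨
        2 * b * q + s ≤ M + 2 * b ∧
          (if s < b then (s + 1) / 2 else (s - b + 2) / 2) + 1 ≤ p) →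
      IsGreatest {n : ℤ | ¬ ∃ x0 x1 x2 x3 x4 x5 : ℕ,
            n = ((x0 * a + x1 * (h * a + d) + x2 * (h * a + 2 * d) + x3 * (h * a + b * d)
              + x4 * (h * a + (b + 1) * d) + x5 * (h * a + 2 * b * d) : ℕ) : ℤ)}
        (((q : ℤ) + p) * ((h : ℤ) * a) + (M : ℤ) * d - a) := by
    intro M hMa hM hcount hs
    refine ⟨not_representable_of_partCount_eq hb hodd hgcd hpq hMa (by omega) hcount,
      fun n hn ↦ not_lt.mp fun hlt ↦ hn (representable_of_partCount_le (by omega) ha hgcd hgap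
        (fun r hr ↦ ?_) hlt)⟩
    rcases lt_or_ge r (2 * b * q) with hlt | hge
    · exact .inl ⟨by omega, hlow hlt⟩
    · obtain ⟨s, hsj, rfl, hc⟩ := hhigh hge hr
      rcases hs s hsj with hs | hs <;> omega
  rw [← hq, ← hj, show (b - 1) / 2 = p by omega]
  refine ⟨fun hjr ↦ ?_, fun hjr ↦ ?_, fun hjr ↦ ?_, fun hjr ↦ ?_, fun hjr ↦ ?_⟩
  · convert key (2 * b * (q - 1) + (2 * b - 1)) (by omega) (by omega) ?_ ?_ using 1
    · rw [show 2 * b * (q - 1) + (2 * b - 1) = 2 * b * q - 1 by omega, Nat.cast_sub (by omega)]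
      push_cast
      ring
    · rw [partCount_mul_add (by omega)]
      split_ifs <;> omega
    · intro s hs
      split_ifs <;> omega
  · convert key (2 * b * q + (b - 2)) (by omega) (by omega) ?_ ?_ using 1
    · push_cast [show 2 ≤ b by omega]
      ring
    · rw [partCount_mul_add (by omega)]
      split_ifs <;> omega
    · intro s hs
      split_ifs <;> omega
  · convert key (2 * b * q + (b - 1)) (by omega) (by omega) ?_ ?_ using 1
    · push_cast [show 1 ≤ b by omega]
      ring
    · rw [partCount_mul_add (by omega)]
      split_ifs <;> omega
    · intro s hs
      split_ifs <;> omega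
  · convert key (2 * b * q + (2 * b - 3)) (by omega) (by omega) ?_ ?_ using 1
    · push_cast [show 3 ≤ 2 * b by omega]
      ring
    · rw [partCount_mul_add (by omega)]
      split_ifs <;> omega
    · intro s hs
      split_ifs <;> omega
  · convert key (2 * b * q + (2 * b - 2)) (by omega) (by omega) ?_ ?_ using 1
    · push_cast [show 2 ≤ 2 * b by omega]
      ring
    · rw [partCount_mul_add (by omega)]
      split_ifs <;> omega
    · intro s hs
      split_ifs <;> omega
end

section
/- Let b ≥ 3 be an integer, and let a,h,d be positive integers with gcd(a,d)=1, h ≥ ⌈d/(b−2)⌉ and a ≥ 2b²−5b+2. Let A(a) = (a, ha+d, ha+bd, ha+(2b−1)d) and write j = a mod (2b−1). Then: g(A(a)) = (⌊a/(2b−1)⌋ + b − 2)ha + (2b−1)d⌊a/(2b−1)⌋ − a − d if j ∈ {0,1,...,b−2}; g(A(a)) = (⌊a/(2b−1)⌋ + b − 2)ha + (2b−1)d⌊a/(2b−1)⌋ − a + (b−2)d if j = b−1; g(A(a)) = (⌊a/(2b−1)⌋ + b − 1)ha + (2b−1)d⌊a/(2b−1)⌋ − a + (b−1)d if j ∈ {b,b+1,...,2b−2}.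 -/
/-- With coins `1, b, M` where `M + 1 = 2 * b`, the greedy representation
`k * M + e * b + r` uses the fewest coins. -/
theorem greedy_coin_count_le {b M k e r x1 x2 x3 : ℕ} (hM : M + 1 = 2 * b)
    (her : e * b + r < M) (hr : r < b)
    (hx : x1 + b * x2 + M * x3 = k * M + e * b + r) :
    k + e + r ≤ x1 + x2 + x3 := by
  have hk : x3 ≤ k := by
    by_contra! hlt
    nlinarith [Nat.mul_le_mul_left M hlt]
  obtain ⟨t, rfl⟩ := Nat.exists_eq_add_of_le hk
  have hx' : x1 + b * x2 = t * M + e * b + r := by linarith [mul_comm M x3, add_mul x3 t M]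
  have hx2 : x2 ≤ 2 * t + e := by
    by_contra! hlt
    nlinarith [Nat.mul_le_mul_left b hlt, congrArg (t * ·) hM]
  have hb : 1 ≤ b := by omega
  obtain ⟨c, rfl⟩ := Nat.exists_eq_add_of_le hb
  have hMc : M = 2 * c + 1 := by omega
  subst hMc
  nlinarith [Nat.mul_le_mul_left c hx2]

/-- Every `n` is paid with coins `1, b, M` using `n / M` coins `M` and at most one coin `b`. -/
theorem exists_greedy_coins (b M n : ℕ) :
    ∃ x1 x2 x3 : ℕ, x1 + b * x2 + M * x3 = n ∧ x3 = n / M ∧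
      (n % M < b ∧ x1 = n % M ∧ x2 = 0 ∨ b ≤ n % M ∧ x1 + b = n % M ∧ x2 = 1) := by
  have hn := Nat.mod_add_div n M
  rcases lt_or_ge (n % M) b with hlt | hle
  · exact ⟨n % M, 0, n / M, by simpa using hn, rfl, Or.inl ⟨hlt, rfl, rfl⟩⟩
  · exact ⟨n % M - b, 1, n / M, by omega, rfl, Or.inr ⟨hle, by omega, rfl⟩⟩

/-- The Frobenius number of `(a, h a + d, h a + b d, h a + M d)` is `p (h a) + n d - a`, where
`n = k * M + e * b + r < a` is paid greedily with `p = k + e + r` coins, provided this residue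
class is the most expensive one. -/
theorem isGreatest_of_worst_residue {b M a h d k e r : ℕ} (hM : M + 1 = 2 * b)
    (hgcd : Nat.gcd a d = 1) (hd : (b - 2) * d ≤ h * a)
    (hn : k * M + e * b + r < a) (her : e * b + r < M) (hr : r < b)
    (hlarge : (k + e + r) * M < k * M + e * b + r + a + M)
    (hup : ∀ n < a, ∃ x1 x2 x3 : ℕ, x1 + b * x2 + M * x3 = n ∧
      (x1 + x2 + x3 ≤ k + e + r ∧ n ≤ k * M + e * b + r ∨
        x1 + x2 + x3 + 1 ≤ k + e + r ∧ n ≤ k * M + e * b + r + (b - 2))) :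
    IsGreatest {n : ℤ | ¬ ∃ x0 x1 x2 x3 : ℕ,
        n = ((x0 * a + x1 * (h * a + d) + x2 * (h * a + b * d)
          + x3 * (h * a + M * d) : ℕ) : ℤ)}
      (((k + e + r : ℕ) : ℤ) * (h * a) + ((k * M + e * b + r : ℕ) : ℤ) * d - a) := by
  have hcop : IsCoprime (a : ℤ) (d : ℤ) := Nat.isCoprime_iff_coprime.mpr hgcd
  have ha : 0 < (a : ℤ) := by omega
  constructor
  · rintro ⟨x0, x1, x2, x3, hx⟩
    have hcoin := @greedy_coin_count_le b M k e r x1 x2 x3 hM her hr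
    generalize hp : k + e + r = p at *
    generalize hN : k * M + e * b + r = N at *
    obtain ⟨S, hS⟩ : ∃ S, S = x1 + x2 + x3 := ⟨_, rfl⟩
    obtain ⟨n, hnx⟩ : ∃ n, n = x1 + b * x2 + M * x3 := ⟨_, rfl⟩
    have hx' : (p : ℤ) * (h * a) + N * d - a = x0 * a + S * (h * a) + n * d := by
      rw [hx, hS, hnx]; push_cast; ring
    have hdvd : (a : ℤ) ∣ (n : ℤ) - N := by
      refine hcop.dvd_of_dvd_mul_right ⟨p * h - 1 - x0 - S * h, ?_⟩
      linear_combination -hx'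
    obtain ⟨m, hm⟩ := hdvd
    have hm0 : 0 ≤ m := by
      by_contra! hlt
      nlinarith
    have hlt : x0 + (S : ℤ) * h + m * d = p * h - 1 := by
      refine mul_left_cancel₀ ha.ne' ?_
      linear_combination -hx' - d * hm
    have hpS : p ≤ S := by
      rcases hm0.eq_or_lt with rfl | hpos
      · rw [hS]
        refine hcoin ?_
        rw [← hnx]
        have : (n : ℤ) - N = 0 := by simpa using hm
        omega
      · have hna : N + a ≤ n := by
          have : (a : ℤ) * 1 ≤ a * m := by gcongr; omega
          omega
        have hnS : n ≤ S * M := by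
          have hb : b ≤ M := by omega
          have h1 : 1 ≤ M := by omega
          rw [hnx, hS]
          nlinarith [Nat.mul_le_mul_left x1 h1, Nat.mul_le_mul_left x2 hb]
        by_contra! hcon
        nlinarith [Nat.mul_le_mul_right M hcon]
    have : (p : ℤ) * h ≤ S * h := by gcongr
    have : (0 : ℤ) ≤ m * d := by positivity
    omega
  · intro z hz
    by_contra! hlt
    refine hz ?_
    obtain ⟨u, v, huv⟩ := hcop
    obtain ⟨n, hna⟩ : ∃ n : ℕ, (n : ℤ) = (z * v) % a :=
      ⟨((z * v) % a).toNat, Int.toNat_of_nonneg (Int.emod_nonneg _ ha.ne')⟩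
    have hlt_a : n < a := by
      have := Int.emod_lt_of_pos (z * v) ha
      omega
    obtain ⟨x1, x2, x3, hx, hcase⟩ := hup n hlt_a
    generalize hp : k + e + r = p at *
    generalize hN : k * M + e * b + r = N at *
    obtain ⟨S, hS⟩ : ∃ S, S = x1 + x2 + x3 := ⟨_, rfl⟩
    rw [← hS] at hcase
    have hcost : S * (h * a) + n * d ≤ p * (h * a) + N * d := by
      rcases hcase with ⟨h1, h2⟩ | ⟨h1, h2⟩
      · gcongr
      · have hcount := Nat.mul_le_mul_right (h * a) h1
        have hvalue := Nat.mul_le_mul_right d h2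
        rw [add_mul] at hcount hvalue
        linarith only [hcount, hvalue, hd]
    have hdvd : (a : ℤ) ∣ z - (S * (h * a) + n * d) := by
      refine ⟨z * u + (z * v / a) * d - S * h, ?_⟩
      have := Int.emod_add_mul_ediv (z * v) a
      linear_combination -z * huv - d * this - d * hna
    obtain ⟨m, hm⟩ := hdvd
    have hm0 : 0 ≤ m := by
      have : (S : ℤ) * (h * a) + n * d ≤ p * (h * a) + N * d := by exact_mod_cast hcost
      by_contra! hneg
      have : (a : ℤ) * m ≤ a * (-1) := by gcongr; omega
      linarith
    refine ⟨m.toNat, x1, x2, x3, ?_⟩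
    push_cast
    rw [Int.toNat_of_nonneg hm0]
    have hS' : (S : ℤ) = x1 + x2 + x3 := by exact_mod_cast hS
    have hx' : (x1 + b * x2 + M * x3 : ℤ) = n := by exact_mod_cast hx
    linear_combination hm + (h * a : ℤ) * hS' - d * hx'

theorem stmt_12 (b a h d : ℕ) (hb : 3 ≤ b)
    (ha : 0 < a) (hh : 0 < h) (hd : 0 < d) (hgcd : Nat.gcd a d = 1)
    (hhd : d ⌈/⌉ (b - 2) ≤ h) (ha' : 2 * b ^ 2 - 5 * b + 2 ≤ a) :
    (a % (2 * b - 1) ≤ b - 2 →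
      IsGreatest {n : ℤ | ¬ ∃ x0 x1 x2 x3 : ℕ,
          n = ((x0 * a + x1 * (h * a + d) + x2 * (h * a + b * d)
            + x3 * (h * a + (2 * b - 1) * d) : ℕ) : ℤ)}
        ((((a / (2 * b - 1) : ℕ) : ℤ) + (b : ℤ) - 2) * ((h : ℤ) * a)
          + (2 * (b : ℤ) - 1) * d * ((a / (2 * b - 1) : ℕ) : ℤ) - a - d)) ∧
    (a % (2 * b - 1) = b - 1 →
      IsGreatest {n : ℤ | ¬ ∃ x0 x1 x2 x3 : ℕ,
          n = ((x0 * a + x1 * (h * a + d) + x2 * (h * a + b * d)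
            + x3 * (h * a + (2 * b - 1) * d) : ℕ) : ℤ)}
        ((((a / (2 * b - 1) : ℕ) : ℤ) + (b : ℤ) - 2) * ((h : ℤ) * a)
          + (2 * (b : ℤ) - 1) * d * ((a / (2 * b - 1) : ℕ) : ℤ) - a + ((b : ℤ) - 2) * d)) ∧
    (b ≤ a % (2 * b - 1) →
      IsGreatest {n : ℤ | ¬ ∃ x0 x1 x2 x3 : ℕ,
          n = ((x0 * a + x1 * (h * a + d) + x2 * (h * a + b * d)
            + x3 * (h * a + (2 * b - 1) * d) : ℕ) : ℤ)}
        ((((a / (2 * b - 1) : ℕ) : ℤ) + (b : ℤ) - 1) * ((h : ℤ) * a)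
          + (2 * (b : ℤ) - 1) * d * ((a / (2 * b - 1) : ℕ) : ℤ) - a + ((b : ℤ) - 1) * d)) := by
  obtain ⟨c, rfl⟩ := Nat.exists_eq_add_of_le' (show 2 ≤ b by omega)
  have hdc : d ≤ (c + 2 - 2) * h := by
    have hpos : 0 < c + 2 - 2 := by omega
    simpa using (ceilDiv_le_iff_le_mul hpos).mp hhd
  simp only [Nat.add_sub_cancel] at hdc
  have hac : (2 * c + 3) * c ≤ a := by
    refine le_trans (le_of_eq ?_) ha'
    have hsq : 2 * (c + 2) ^ 2 + 2 = (2 * c + 3) * c + 5 * (c + 2) := by ring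
    have hpos : 2 ≤ (2 * c + 3) * c := by nlinarith
    omega
  have hd' : (c + 2 - 2) * d ≤ h * a := by
    simp only [Nat.add_sub_cancel]
    calc c * d ≤ c * (c * h) := by gcongr
      _ = h * (c * c) := by ring
      _ ≤ h * a := by gcongr; nlinarith
  obtain ⟨M, hM⟩ : ∃ M, M = 2 * (c + 2) - 1 := ⟨_, rfl⟩
  have hM1 : M + 1 = 2 * (c + 2) := by omega
  have hMc : M = 2 * c + 3 := by omega
  have hMz : (2 * ((c + 2 : ℕ) : ℤ) - 1) = M := by omega
  rw [← hMc] at hac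
  rw [← hM, hMz]
  have hq := Nat.div_add_mod a M
  have hj := Nat.mod_lt a (show 0 < M by omega)
  obtain ⟨q, hqdef⟩ : ∃ q, q = a / M := ⟨_, rfl⟩
  obtain ⟨j, hjdef⟩ : ∃ j, j = a % M := ⟨_, rfl⟩
  rw [← hqdef, ← hjdef] at hq
  rw [← hjdef] at hj
  rw [← hqdef, ← hjdef]
  have hcoins : ∀ n < a, ∃ x1 x2 x3 s : ℕ, x1 + (c + 2) * x2 + M * x3 = n ∧ n = M * x3 + s ∧
      s < M ∧ (x3 = q ∧ s < j ∨ x3 + 1 ≤ q ∧ M * x3 + M ≤ M * q) ∧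
      (s < c + 2 ∧ x1 = s ∧ x2 = 0 ∨ c + 2 ≤ s ∧ x1 + (c + 2) = s ∧ x2 = 1) := by
    intro n hn
    obtain ⟨x1, x2, x3, hx, hx3, hcase⟩ := exists_greedy_coins (c + 2) M n
    have hnm := Nat.div_add_mod n M
    rw [← hx3] at hnm
    refine ⟨x1, x2, x3, n % M, hx, hnm.symm, Nat.mod_lt _ (by omega), ?_, hcase⟩
    have hle : x3 ≤ q := by rw [hx3, hqdef]; exact Nat.div_le_div_right hn.le
    rcases hle.eq_or_lt with rfl | hlt
    · left; omega
    · right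
      have := Nat.mul_le_mul_left M hlt
      rw [Nat.succ_eq_add_one, mul_add, mul_one] at this
      omega
  refine ⟨fun hcase => ?_, fun hcase => ?_, fun hcase => ?_⟩
  · have hq1 : 1 ≤ q := by
      by_contra! hq0
      have : q = 0 := by omega
      subst this
      nlinarith
    obtain ⟨k, rfl⟩ := Nat.exists_eq_add_of_le' hq1
    have hk : M * (k + 1) = k * M + M := by ring
    convert isGreatest_of_worst_residue (k := k) (e := 1) (r := c) hM1 hgcd hd' ?_ ?_ ?_ ?_ ?_
      using 1
    · rw [hMc]; push_cast; ring
    · omega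
    · omega
    · omega
    · nlinarith
    · intro n hn
      obtain ⟨x1, x2, x3, s, hx, hns, hs, h1, h2⟩ := hcoins n hn
      refine ⟨x1, x2, x3, hx, ?_⟩
      rcases h1 with ⟨rfl, h1⟩ | h1 <;> omega
  · have hk : M * q = q * M := by ring
    convert isGreatest_of_worst_residue (k := q) (e := 0) (r := c) hM1 hgcd hd' ?_ ?_ ?_ ?_ ?_
      using 1
    · rw [hMc]; push_cast; ring
    · omega
    · omega
    · omega
    · nlinarith
    · intro n hn
      obtain ⟨x1, x2, x3, s, hx, hns, hs, h1, h2⟩ := hcoins n hn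
      refine ⟨x1, x2, x3, hx, ?_⟩
      rcases h1 with ⟨rfl, h1⟩ | h1 <;> omega
  · have hk : M * q = q * M := by ring
    convert isGreatest_of_worst_residue (k := q) (e := 0) (r := c + 1) hM1 hgcd hd' ?_ ?_ ?_ ?_ ?_
      using 1
    · rw [hMc]; push_cast; ring
    · omega
    · omega
    · omega
    · nlinarith
    · intro n hn
      obtain ⟨x1, x2, x3, s, hx, hns, hs, h1, h2⟩ := hcoins n hn
      refine ⟨x1, x2, x3, hx, ?_⟩
      rcases h1 with ⟨rfl, h1⟩ | h1 <;> omega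
end

section
/- Let k ≥ 2 and K be positive integers with K − 1 > k, and write K = sk + t with 0 ≤ t ≤ k−1, s ≥ 1. Assume 2 ≤ t ≤ k−1. Let a,h,d be positive integers with gcd(a,d)=1, h ≥ ⌈d/s⌉ and a ≥ sK. Let A(a) = (a, ha+d, ha+2d, ..., ha+kd, ha+Kd) and write j = a mod K. Then: g(A(a)) = (⌊a/K⌋ + s)ha + Kd⌊a/K⌋ − a − d if j ∈ {0,1,...,(s−1)k+1}; g(A(a)) = (⌊a/K⌋ + s)ha + Kd⌊a/K⌋ − a + (j−1)d if j ∈ {(s−1)k+2,...,sk+1}; g(A(a)) = (⌊a/K⌋ + s + 1)ha + Kd⌊a/K⌋ − a + (j−1)d if j ∈ {sk+2,...,K−1}. -/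
/-- The total value of a combination, in terms of the number of parts and of their sum. -/
lemma sum_mul_arith_progression (k a h d : ℕ) (x : ℕ → ℕ) :
    ∑ i ∈ Finset.Icc 1 k, x i * (h * a + i * d)
      = h * a * (∑ i ∈ Finset.Icc 1 k, x i) + d * (∑ i ∈ Finset.Icc 1 k, x i * i) := by
  rw [Finset.mul_sum, Finset.mul_sum, ← Finset.sum_add_distrib]
  exact Finset.sum_congr rfl fun i _ => by ring

lemma sum_mul_le_mul_sum (k : ℕ) (x : ℕ → ℕ) :
    ∑ i ∈ Finset.Icc 1 k, x i * i ≤ k * ∑ i ∈ Finset.Icc 1 k, x i := by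
  rw [Finset.mul_sum]
  refine Finset.sum_le_sum fun i hi => ?_
  rw [mul_comm]
  exact Nat.mul_le_mul_right _ (Finset.mem_Icc.1 hi).2

/-- Every `i ≤ p * k` is a sum of at most `p` parts from `1, …, k`. -/
lemma exists_parts_le (k p i : ℕ) (hk : 0 < k) (hi : i ≤ p * k) :
    ∃ x : ℕ → ℕ, ∑ j ∈ Finset.Icc 1 k, x j * j = i ∧ ∑ j ∈ Finset.Icc 1 k, x j ≤ p := by
  have hlt := Nat.mod_lt i hk
  have hdm := Nat.div_add_mod i k
  refine ⟨fun j => (if j = k then i / k else 0) + if j = i % k then 1 else 0, ?_, ?_⟩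
  · simp only [add_mul, ite_mul, zero_mul, one_mul, Finset.sum_add_distrib,
      Finset.sum_ite_eq', Finset.mem_Icc]
    rw [if_pos ⟨hk, le_rfl⟩, mul_comm]
    split_ifs <;> omega
  · simp only [Finset.sum_add_distrib, Finset.sum_ite_eq', Finset.mem_Icc]
    rw [if_pos ⟨hk, le_rfl⟩]
    split_ifs with h
    · have : k * (i / k) < k * p := by rw [mul_comm k p]; omega
      exact Nat.lt_of_mul_lt_mul_left this
    · exact Nat.div_le_of_le_mul (by rwa [mul_comm])

/-- A sum `q * K + i` with `p * k < i < K` of parts from `1, …, k, K` has more than `q + p` parts. -/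
lemma lt_card_parts (k K q i p y : ℕ) (x : ℕ → ℕ) (hkK : k ≤ K) (hiK : i < K) (hip : p * k < i)
    (hsum : ∑ j ∈ Finset.Icc 1 k, x j * j + y * K = q * K + i) :
    q + p < ∑ j ∈ Finset.Icc 1 k, x j + y := by
  have hle := sum_mul_le_mul_sum k x
  have hyq : y ≤ q := by
    by_contra! hlt
    have := Nat.mul_le_mul_right K (Nat.succ_le_of_lt hlt)
    rw [Nat.succ_mul] at this
    omega
  obtain ⟨e, rfl⟩ := Nat.exists_eq_add_of_le hyq
  have hek := Nat.mul_le_mul_left e hkK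
  have : k * (e + p) < k * ∑ j ∈ Finset.Icc 1 k, x j := by nlinarith
  have := Nat.lt_of_mul_lt_mul_left this
  omega

lemma sum_le_mul_card_parts (k K y : ℕ) (x : ℕ → ℕ) (hkK : k ≤ K) :
    ∑ j ∈ Finset.Icc 1 k, x j * j + y * K ≤ K * (∑ j ∈ Finset.Icc 1 k, x j + y) := by
  have := sum_mul_le_mul_sum k x
  have := Nat.mul_le_mul_right (∑ j ∈ Finset.Icc 1 k, x j) hkK
  nlinarith

/-- If `h * a * c + d * M` is the largest minimal representable number in its class modulo `a`,
subtracting `a` gives the Frobenius number. -/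
lemma isGreatest_not_representable_s13 (k K a h d c M : ℕ) (ha : 0 < a) (hgcd : Nat.gcd a d = 1)
    (hM : M < a)
    (hlow : ∀ (x : ℕ → ℕ) (y l : ℕ), ∑ j ∈ Finset.Icc 1 k, x j * j + y * K = M + l * a →
      c ≤ ∑ j ∈ Finset.Icc 1 k, x j + y)
    (hup : ∀ r < a, ∃ (x : ℕ → ℕ) (y : ℕ), ∑ j ∈ Finset.Icc 1 k, x j * j + y * K = r ∧
      h * a * (∑ j ∈ Finset.Icc 1 k, x j + y) + d * r ≤ h * a * c + d * M) :
    IsGreatest {n : ℤ | ¬ ∃ x0 y : ℕ, ∃ x : ℕ → ℕ,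
        n = ((x0 * a + (∑ i ∈ Finset.Icc 1 k, x i * (h * a + i * d))
          + y * (h * a + K * d) : ℕ) : ℤ)}
      ((h : ℤ) * a * c + d * M - a) := by
  have hval : ∀ (x : ℕ → ℕ) (x0 y : ℕ), x0 * a + (∑ i ∈ Finset.Icc 1 k, x i * (h * a + i * d))
      + y * (h * a + K * d) = x0 * a + h * a * (∑ j ∈ Finset.Icc 1 k, x j + y)
        + d * (∑ j ∈ Finset.Icc 1 k, x j * j + y * K) := fun x x0 y => by
    rw [sum_mul_arith_progression]; ring
  have hcop : IsCoprime (a : ℤ) d := Nat.isCoprime_iff_coprime.2 hgcd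
  constructor
  · rintro ⟨x0, y, x, hn⟩
    rw [hval] at hn
    set m := ∑ j ∈ Finset.Icc 1 k, x j + y with hm
    set S := ∑ j ∈ Finset.Icc 1 k, x j * j + y * K with hS
    push_cast at hn
    have hdvd : (a : ℤ) ∣ (S : ℤ) - M := hcop.dvd_of_dvd_mul_left
      ⟨h * c - 1 - x0 - h * m, by linear_combination -hn⟩
    have hmod : S % a = M := by
      have := (Nat.modEq_iff_dvd.2 hdvd).symm
      rwa [Nat.ModEq, Nat.mod_eq_of_lt hM] at this
    have hS' : S = M + S / a * a := by
      have := Nat.mod_add_div S a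
      rw [hmod, mul_comm] at this
      exact this.symm
    have hcm : c ≤ m := hlow x y (S / a) hS'
    have hMS : M ≤ S := by omega
    have h1 := Nat.mul_le_mul_left (h * a) hcm
    have h2 := Nat.mul_le_mul_left d hMS
    zify at h1 h2
    have : (0 : ℤ) ≤ x0 * a := by positivity
    have : (0 : ℤ) < a := by exact_mod_cast ha
    linarith
  · intro n hn
    by_contra! hlt
    apply hn
    obtain ⟨u, v, huv⟩ := hcop
    have ha' : (0 : ℤ) < a := by exact_mod_cast ha
    obtain ⟨r, hr⟩ := Int.eq_ofNat_of_zero_le (Int.emod_nonneg (n * v) ha'.ne')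
    have hra : r < a := by
      have := Int.emod_lt_of_pos (n * v) ha'
      rw [hr] at this
      exact_mod_cast this
    obtain ⟨x, y, hxr, hle⟩ := hup r hra
    set m := ∑ j ∈ Finset.Icc 1 k, x j + y with hm
    have hdm := Int.emod_add_mul_ediv (n * v) a
    rw [hr] at hdm
    set w := n * v / (a : ℤ) with hw
    -- the quotient of `n - (h * a * m + d * r)` by `a`
    have hq : n - (h * a * m + d * r) = a * (n * u + d * w - h * m) := by
      linear_combination (-n) * huv - d * hdm
    have hle' : (h : ℤ) * a * m + d * r ≤ h * a * c + d * M := by exact_mod_cast hle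
    have hpos : 0 ≤ n * u + d * w - h * m := by
      have : (a : ℤ) * (-1) < a * (n * u + d * w - h * m) := by linarith
      have := lt_of_mul_lt_mul_left this ha'.le
      omega
    obtain ⟨x0, hx0⟩ := Int.eq_ofNat_of_zero_le hpos
    refine ⟨x0, y, x, ?_⟩
    rw [hval, hxr, ← hm]
    push_cast
    rw [hx0] at hq
    linear_combination hq

theorem stmt_13 (k K s t a h d : ℕ) (hk : 2 ≤ k) (hK : k < K - 1)
    (hst : K = s * k + t) (ht : t ≤ k - 1) (hs : 1 ≤ s) (ht2 : 2 ≤ t)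
    (ha : 0 < a) (hh : 0 < h) (hd : 0 < d) (hgcd : Nat.gcd a d = 1)
    (hhd : d ⌈/⌉ s ≤ h) (ha' : s * K ≤ a) :
    (a % K ≤ (s - 1) * k + 1 →
      IsGreatest {n : ℤ | ¬ ∃ x0 y : ℕ, ∃ x : ℕ → ℕ,
          n = ((x0 * a + (∑ i ∈ Finset.Icc 1 k, x i * (h * a + i * d))
            + y * (h * a + K * d) : ℕ) : ℤ)}
        ((((a / K : ℕ) : ℤ) + (s : ℤ)) * ((h : ℤ) * a)
          + (K : ℤ) * d * ((a / K : ℕ) : ℤ) - a - d)) ∧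
    ((s - 1) * k + 2 ≤ a % K ∧ a % K ≤ s * k + 1 →
      IsGreatest {n : ℤ | ¬ ∃ x0 y : ℕ, ∃ x : ℕ → ℕ,
          n = ((x0 * a + (∑ i ∈ Finset.Icc 1 k, x i * (h * a + i * d))
            + y * (h * a + K * d) : ℕ) : ℤ)}
        ((((a / K : ℕ) : ℤ) + (s : ℤ)) * ((h : ℤ) * a)
          + (K : ℤ) * d * ((a / K : ℕ) : ℤ) - a + (((a % K : ℕ) : ℤ) - 1) * d)) ∧
    (s * k + 2 ≤ a % K →
      IsGreatest {n : ℤ | ¬ ∃ x0 y : ℕ, ∃ x : ℕ → ℕ,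
          n = ((x0 * a + (∑ i ∈ Finset.Icc 1 k, x i * (h * a + i * d))
            + y * (h * a + K * d) : ℕ) : ℤ)}
        ((((a / K : ℕ) : ℤ) + (s : ℤ) + 1) * ((h : ℤ) * a)
          + (K : ℤ) * d * ((a / K : ℕ) : ℤ) - a + (((a % K : ℕ) : ℤ) - 1) * d)) := by
  have hsh : d ≤ s * h := by
    have := (ceilDiv_le_iff_le_mul (by omega : 0 < s)).1 hhd
    simpa [mul_comm] using this
  have hkK : k ≤ K := by omega
  have hK0 : 0 < K := by omega
  have hdK : d * K ≤ h * a := by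
    calc d * K ≤ s * h * K := Nat.mul_le_mul_right _ hsh
      _ = h * (s * K) := by ring
      _ ≤ h * a := Nat.mul_le_mul_left _ ha'
  have hsQ : s ≤ a / K := (Nat.le_div_iff_mul_le hK0).2 ha'
  have hjK : a % K < K := Nat.mod_lt _ hK0
  have haQ : a = a / K * K + a % K := by rw [mul_comm]; exact (Nat.div_add_mod a K).symm
  set Q := a / K with hQ
  set j := a % K with hj
  have hKs : K ≤ (s + 1) * k := by rw [Nat.succ_mul]; omega
  obtain ⟨s, rfl⟩ : ∃ s', s = s' + 1 := ⟨s - 1, by omega⟩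
  obtain ⟨P, hP⟩ : ∃ P, Q = P + 1 := ⟨Q - 1, by omega⟩
  clear_value Q j
  subst hP
  rw [Nat.add_sub_cancel]
  have hsk : (s + 1) * k = s * k + k := Nat.succ_mul s k
  have hrep : ∀ q i p : ℕ, i ≤ p * k → ∃ (x : ℕ → ℕ) (y : ℕ),
      ∑ j ∈ Finset.Icc 1 k, x j * j + y * K = q * K + i ∧
        ∑ j ∈ Finset.Icc 1 k, x j + y ≤ q + p := by
    intro q i p hip
    obtain ⟨x, hx, hxp⟩ := exists_parts_le k p i (by omega) hip
    exact ⟨x, q, by omega, by omega⟩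
  have hwrap : ∀ (M b l y : ℕ) (x : ℕ → ℕ),
      ∑ j ∈ Finset.Icc 1 k, x j * j + y * K = M + (l + 1) * a →
      K * b < M + a → b < ∑ j ∈ Finset.Icc 1 k, x j + y := by
    intro M b l y x hx hb
    have h1 := sum_le_mul_card_parts k K y x hkK
    refine Nat.lt_of_mul_lt_mul_left (a := K) ?_
    have : (l + 1) * a = l * a + a := Nat.succ_mul l a
    have := Nat.zero_le (l * a)
    omega
  have hPK : (P + 1) * K = P * K + K := Nat.succ_mul P K
  have hsP : (s + 1) * K ≤ (P + 1) * K := Nat.mul_le_mul_right _ hsQ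
  have hcost : ∀ q i p c M : ℕ, i ≤ p * k → q + p ≤ c → q * K + i ≤ M →
      ∃ (x : ℕ → ℕ) (y : ℕ), ∑ j ∈ Finset.Icc 1 k, x j * j + y * K = q * K + i ∧
        h * a * (∑ j ∈ Finset.Icc 1 k, x j + y) + d * (q * K + i) ≤ h * a * c + d * M := by
    intro q i p c M hip hc hM
    obtain ⟨x, y, hx, hm⟩ := hrep q i p hip
    exact ⟨x, y, hx, by gcongr; omega⟩
  have hsplit : ∀ r < a, ∃ q i, r = q * K + i ∧ i < K ∧
      (q ≤ P ∧ r ≤ P * K + (K - 1) ∨ q = P + 1 ∧ i < j) := by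
    intro r hr
    have hi := Nat.mod_lt r hK0
    have hr' : r = r / K * K + r % K := by rw [mul_comm]; exact (Nat.div_add_mod r K).symm
    refine ⟨r / K, r % K, hr', hi, ?_⟩
    rcases Nat.lt_trichotomy (r / K) (P + 1) with hq | hq | hq
    · left
      have := Nat.mul_le_mul_right K (Nat.le_of_lt_succ hq)
      omega
    · right
      rw [hq] at hr'
      omega
    · have := Nat.mul_le_mul_right K (Nat.succ_le_of_lt hq)
      rw [Nat.succ_mul] at this
      omega
  have hKs' : K ≤ (s + 2) * k := hKs
  refine ⟨fun hj1 => ?_, fun hj2 => ?_, fun hj3 => ?_⟩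
  · have key := isGreatest_not_representable_s13 k K a h d (P + 1 + (s + 1)) (P * K + (K - 1)) ha hgcd
      (by omega) ?_ ?_
    · convert key using 1
      have : ((K - 1 : ℕ) : ℤ) = K - 1 := by omega
      push_cast [this]
      ring
    · rintro x y (_ | l) hx
      · have := lt_card_parts k K P (K - 1) (s + 1) y x hkK (by omega) (by omega) (by omega)
        omega
      · have := hwrap _ (P + 1 + s) l y x hx (by nlinarith)
        omega
    · intro r hr
      obtain ⟨q, i, rfl, hi, ⟨hq, hrM⟩ | ⟨rfl, hij⟩⟩ := hsplit r hr
      · exact hcost q i (s + 2) _ _ (by omega) (by omega) hrM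
      · obtain ⟨x, y, hx, hm⟩ := hrep (P + 1) i s (by omega)
        refine ⟨x, y, hx, ?_⟩
        calc _ ≤ h * a * (P + 1 + s) + d * (P * K + (K - 1) + K) :=
              Nat.add_le_add (Nat.mul_le_mul_left _ hm) (Nat.mul_le_mul_left _ (by omega))
          _ = h * a * (P + 1 + s) + d * (P * K + (K - 1)) + d * K := by ring
          _ ≤ h * a * (P + 1 + s) + d * (P * K + (K - 1)) + h * a := by gcongr
          _ = _ := by ring
  · have key := isGreatest_not_representable_s13 k K a h d (P + 1 + (s + 1)) ((P + 1) * K + (j - 1))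
      ha hgcd (by omega) ?_ ?_
    · convert key using 1
      have : ((j - 1 : ℕ) : ℤ) = j - 1 := by omega
      push_cast [this]
      ring
    · rintro x y (_ | l) hx
      · have := lt_card_parts k K (P + 1) (j - 1) s y x hkK (by omega) (by omega) (by omega)
        omega
      · have := hwrap _ (P + 1 + s) l y x hx (by nlinarith)
        omega
    · intro r hr
      obtain ⟨q, i, rfl, hi, ⟨hq, hrM⟩ | ⟨rfl, hij⟩⟩ := hsplit r hr
      · exact hcost q i (s + 2) _ _ (by omega) (by omega) (by omega)
      · exact hcost (P + 1) i (s + 1) _ _ (by omega) (by omega) (by omega)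
  · have key := isGreatest_not_representable_s13 k K a h d (P + 1 + (s + 2)) ((P + 1) * K + (j - 1))
      ha hgcd (by omega) ?_ ?_
    · convert key using 1
      have : ((j - 1 : ℕ) : ℤ) = j - 1 := by omega
      push_cast [this]
      ring
    · rintro x y (_ | l) hx
      · have := lt_card_parts k K (P + 1) (j - 1) (s + 1) y x hkK (by omega) (by omega) (by omega)
        omega
      · have := hwrap _ (P + 1 + (s + 1)) l y x hx (by nlinarith)
        omega
    · intro r hr
      obtain ⟨q, i, rfl, hi, ⟨hq, hrM⟩ | ⟨rfl, hij⟩⟩ := hsplit r hr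
      · exact hcost q i (s + 2) _ _ (by omega) (by omega) (by omega)
      · exact hcost (P + 1) i (s + 2) _ _ (by omega) (by omega) (by omega)
end

section
/- Let k ≥ 2 and K be positive integers with K − 1 > k, and write K = sk + t with 0 ≤ t ≤ k−1, s ≥ 1. Assume t ∈ {0,1} (so that s ≥ 2). Let a,h,d be positive integers with gcd(a,d)=1, h ≥ ⌈d/(s−1)⌉ and a ≥ (s−1)K. Let A(a) = (a, ha+d, ha+2d, ..., ha+kd, ha+Kd) and write j = a mod K. Then: g(A(a)) = (⌊a/K⌋ + s − 1)ha + Kd⌊a/K⌋ − a − d if j ∈ {0,1,...,(s−2)k+1}; g(A(a)) = (⌊a/K⌋ + s − 1)ha + Kd⌊a/K⌋ − a + (j−1)d if j ∈ {(s−2)k+2,...,(s−1)k+1}; g(A(a)) = (⌊a/K⌋ + s)ha + Kd⌊a/K⌋ − a + (j−1)d if j ∈ {(s−1)k+2,...,K−1}. -/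
/-- The number of parts used by the greedy representation of `m` by parts `1, …, k, K`. -/
def greedyParts (k K m : ℕ) : ℕ := m / K + (m % K ⌈/⌉ k)

theorem greedyParts_mul_add {k K q r : ℕ} (hr : r < K) :
    greedyParts k K (K * q + r) = q + (r ⌈/⌉ k) := by
  have hK : 0 < K := by omega
  rw [greedyParts, Nat.mul_add_div hK, Nat.mul_add_mod, Nat.div_eq_of_lt hr, Nat.mod_eq_of_lt hr]
  simp

/-- The greedy representation uses the fewest parts. -/
theorem greedyParts_le {k K y n X : ℕ} (hk : 0 < k) (hkK : k ≤ K) (hn : n ≤ k * X) :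
    greedyParts k K (K * y + n) ≤ y + X := by
  have hr : n % K < K := Nat.mod_lt _ (by omega)
  have hdm : K * (n / K) + n % K = n := Nat.div_add_mod n K
  have hsplit : K * y + n = K * (y + n / K) + n % K := by rw [mul_add]; omega
  rw [hsplit, greedyParts_mul_add hr]
  have hq : k * (n / K) ≤ K * (n / K) := Nat.mul_le_mul_right _ hkK
  have hqX : n / K ≤ X := Nat.le_of_mul_le_mul_left (by omega : k * (n / K) ≤ k * X) hk
  have hceil : n % K ⌈/⌉ k ≤ X - n / K := by
    rw [ceilDiv_le_iff_le_mul hk, Nat.mul_sub]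
    omega
  omega

/-- Adding at least `(s - 1) * K` does not lower the greedy number of parts. -/
theorem greedyParts_le_add {k K s m b : ℕ} (hk : 0 < k) (hs : K ≤ s * k + 1)
    (hK : 0 < K) (hb : (s - 1) * K ≤ b) :
    greedyParts k K m ≤ greedyParts k K (m + b) := by
  have hr : m % K < K := Nat.mod_lt _ hK
  have hr' : (m + b) % K < K := Nat.mod_lt _ hK
  have hdm := Nat.div_add_mod m K
  have hdm' := Nat.div_add_mod (m + b) K
  unfold greedyParts
  by_cases hle : m % K ≤ (m + b) % K
  · have hdiv : m / K ≤ (m + b) / K := Nat.div_le_div_right (Nat.le_add_right _ _)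
    have hceil : m % K ⌈/⌉ k ≤ (m + b) % K ⌈/⌉ k := by
      rw [ceilDiv_le_iff_le_mul hk]
      exact hle.trans ((ceilDiv_le_iff_le_mul hk).1 le_rfl)
    omega
  · have hlt : m / K + (s - 1) < (m + b) / K := by
      apply Nat.lt_of_mul_lt_mul_left (a := K)
      rw [mul_add, mul_comm K (s - 1)]
      omega
    have hceil : m % K ⌈/⌉ k ≤ s := by
      rw [ceilDiv_le_iff_le_mul hk, mul_comm]
      omega
    omega

theorem exists_greedy_representation {k K h a d : ℕ} (hk : 0 < k) (m : ℕ) :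
    ∃ y : ℕ, ∃ x : ℕ → ℕ,
      (∑ i ∈ Finset.Icc 1 k, x i * (h * a + i * d)) + y * (h * a + K * d)
        = greedyParts k K m * (h * a) + m * d := by
  obtain ⟨r, hr⟩ : ∃ r, m % K = r := ⟨_, rfl⟩
  have hv : r % k < k := Nat.mod_lt _ hk
  have hdm : k * (r / k) + r % k = r := Nat.div_add_mod r k
  have hm : K * (m / K) + r = m := hr ▸ Nat.div_add_mod m K
  refine ⟨m / K, fun i => (if i = k then r / k else 0) + (if i = r % k then 1 else 0), ?_⟩
  have hsum : (∑ i ∈ Finset.Icc 1 k,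
      ((if i = k then r / k else 0) + (if i = r % k then 1 else 0)) * (h * a + i * d))
      = (r ⌈/⌉ k) * (h * a) + r * d := by
    simp only [add_mul, ite_mul, zero_mul, one_mul, Finset.sum_add_distrib, Finset.sum_ite_eq',
      Finset.mem_Icc]
    rw [if_pos ⟨hk, le_rfl⟩]
    by_cases h0 : r % k = 0
    · have hc : r ⌈/⌉ k = r / k := by
        apply le_antisymm
        · rw [ceilDiv_le_iff_le_mul hk]; omega
        · apply Nat.le_of_mul_le_mul_left _ hk
          have := (ceilDiv_le_iff_le_mul hk).1 (le_refl (r ⌈/⌉ k))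
          omega
      rw [if_neg (by omega), hc]
      calc _ = r / k * (h * a) + (k * (r / k) + 0) * d := by ring
        _ = _ := by rw [← h0, hdm]
    · have hc : r ⌈/⌉ k = r / k + 1 := by
        apply le_antisymm
        · rw [ceilDiv_le_iff_le_mul hk, mul_add]; omega
        · apply Nat.succ_le_of_lt
          apply Nat.lt_of_mul_lt_mul_left (a := k)
          have := (ceilDiv_le_iff_le_mul hk).1 (le_refl (r ⌈/⌉ k))
          omega
      rw [if_pos (by omega), hc]
      calc _ = (r / k + 1) * (h * a) + (k * (r / k) + r % k) * d := by ring
        _ = _ := by rw [hdm]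
  rw [hsum, greedyParts, hr]
  calc _ = (m / K + (r ⌈/⌉ k)) * (h * a) + (K * (m / K) + r) * d := by ring
    _ = _ := by rw [hm]

/-- Every combination has the form `c * (h * a) + m * d` with `c` at least the greedy number of
parts of `m`. -/
theorem exists_parts_of_combination {k K h a d : ℕ} (hk : 0 < k) (hkK : k ≤ K)
    (y : ℕ) (x : ℕ → ℕ) :
    ∃ c m : ℕ, greedyParts k K m ≤ c ∧
      (∑ i ∈ Finset.Icc 1 k, x i * (h * a + i * d)) + y * (h * a + K * d)
        = c * (h * a) + m * d := by
  refine ⟨y + ∑ i ∈ Finset.Icc 1 k, x i, K * y + ∑ i ∈ Finset.Icc 1 k, x i * i,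
    greedyParts_le hk hkK ?_, ?_⟩
  · rw [Finset.mul_sum]
    refine Finset.sum_le_sum fun i hi => ?_
    rw [mul_comm]
    exact Nat.mul_le_mul_right _ (Finset.mem_Icc.1 hi).2
  · simp only [mul_add, Finset.sum_add_distrib, add_mul, Finset.sum_mul, mul_assoc]
    ring

/-- The Frobenius number is the largest Apéry element minus `a`. -/
theorem isGreatest_of_apery_max {k K s a h d R : ℕ} (hk : 0 < k) (hkK : k ≤ K)
    (hs : K ≤ s * k + 1) (hgcd : Nat.gcd a d = 1) (ha' : (s - 1) * K ≤ a) (hR : R < a)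
    (hmax : ∀ r < a, greedyParts k K r * (h * a) + r * d
      ≤ greedyParts k K R * (h * a) + R * d) :
    IsGreatest {n : ℤ | ¬ ∃ x0 y : ℕ, ∃ x : ℕ → ℕ,
          n = ((x0 * a + (∑ i ∈ Finset.Icc 1 k, x i * (h * a + i * d))
            + y * (h * a + K * d) : ℕ) : ℤ)}
      (((greedyParts k K R * (h * a) + R * d : ℕ) : ℤ) - a) := by
  constructor
  · rintro ⟨x0, y, x, hx⟩
    obtain ⟨c, m, hcm, hsum⟩ := exists_parts_of_combination (h := h) (a := a) (d := d) hk hkK y x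
    rw [add_assoc, hsum] at hx
    have hN : greedyParts k K R * (h * a) + R * d = x0 * a + (c * (h * a) + m * d) + a := by
      zify at hx ⊢; linarith
    have hmod : R * d ≡ m * d [MOD a] := by
      have h1 : R * d + a * (greedyParts k K R * h) = m * d + a * (x0 + c * h + 1) := by
        linarith
      have h2 := congrArg (· % a) h1
      simpa [Nat.ModEq] using h2
    have hmod' : R ≡ m [MOD a] := Nat.ModEq.cancel_right_of_coprime hgcd hmod
    have hmR : m % a = R := by rw [← hmod', Nat.mod_eq_of_lt hR]
    have hdm : m = R + a * (m / a) := by have := Nat.div_add_mod m a; omega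
    have hO : greedyParts k K R ≤ greedyParts k K m := by
      rcases Nat.eq_zero_or_pos (m / a) with h0 | h0
      · rw [h0] at hdm
        simp only [mul_zero, add_zero] at hdm
        rw [hdm]
      · rw [hdm]
        exact greedyParts_le_add hk hs (by omega) (ha'.trans (Nat.le_mul_of_pos_right a h0))
    have h1 : greedyParts k K R * (h * a) ≤ c * (h * a) :=
      Nat.mul_le_mul_right _ (hO.trans hcm)
    have h2 : R * d ≤ m * d := Nat.mul_le_mul_right _ (by omega)
    have h3 : 0 ≤ x0 * a := Nat.zero_le _
    omega
  · intro n hn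
    by_contra hlt
    push Not at hlt
    apply hn
    have ha0 : (a : ℤ) ≠ 0 := by omega
    have hcop : IsCoprime (a : ℤ) (d : ℤ) := Nat.isCoprime_iff_coprime.2 hgcd
    obtain ⟨u, v, huv⟩ := hcop
    obtain ⟨r, hr⟩ := Int.eq_ofNat_of_zero_le (Int.emod_nonneg (n * v) ha0)
    have hra : r < a := by
      have := Int.emod_lt_of_pos (n * v) (by omega : (0 : ℤ) < a)
      omega
    obtain ⟨y, x, hyx⟩ := exists_greedy_representation (K := K) (h := h) (a := a) (d := d) hk r
    have hdm := Int.mul_ediv_add_emod (n * v) a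
    rw [hr] at hdm
    have hdvd : ∃ z : ℤ,
        n - ((greedyParts k K r * (h * a) + r * d : ℕ) : ℤ) = z * a := by
      refine ⟨n * u + (n * v / a) * d - greedyParts k K r * h, ?_⟩
      push_cast
      linear_combination (-n) * huv - d * hdm
    obtain ⟨z, hz⟩ := hdvd
    have hle : ((greedyParts k K r * (h * a) + r * d : ℕ) : ℤ)
        ≤ ((greedyParts k K R * (h * a) + R * d : ℕ) : ℤ) := by exact_mod_cast hmax r hra
    have hz0 : 0 ≤ z := by
      have h1 : (-1) * (a : ℤ) < z * a := by linarith
      have := lt_of_mul_lt_mul_right h1 (by omega : (0 : ℤ) ≤ a)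
      omega
    obtain ⟨x0, rfl⟩ := Int.eq_ofNat_of_zero_le hz0
    refine ⟨x0, y, x, ?_⟩
    rw [add_assoc, hyx]
    push_cast at hz ⊢
    linarith

/-- A number below `K * q` has at most `q + s - 1` greedy parts. -/
theorem greedyParts_le_of_lt {k K s q r : ℕ} (hk : 0 < k) (hs : K ≤ s * k + 1) (hr : r < K * q) :
    greedyParts k K r + 1 ≤ q + s := by
  have hK : 0 < K := Nat.pos_of_mul_pos_right (by omega : 0 < K * q)
  have hlt : r / K < q := Nat.div_lt_of_lt_mul hr
  have hr : r % K < K := Nat.mod_lt _ hK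
  have hceil : r % K ⌈/⌉ k ≤ s := by
    rw [ceilDiv_le_iff_le_mul hk, mul_comm]
    omega
  unfold greedyParts
  omega

theorem stmt_14 (k K s t a h d : ℕ) (hk : 2 ≤ k) (hK : k < K - 1)
    (hst : K = s * k + t) (ht : t ≤ k - 1) (hs : 1 ≤ s) (ht1 : t ≤ 1)
    (ha : 0 < a) (hh : 0 < h) (hd : 0 < d) (hgcd : Nat.gcd a d = 1)
    (hhd : d ⌈/⌉ (s - 1) ≤ h) (ha' : (s - 1) * K ≤ a) :
    (a % K ≤ (s - 2) * k + 1 →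
      IsGreatest {n : ℤ | ¬ ∃ x0 y : ℕ, ∃ x : ℕ → ℕ,
          n = ((x0 * a + (∑ i ∈ Finset.Icc 1 k, x i * (h * a + i * d))
            + y * (h * a + K * d) : ℕ) : ℤ)}
        ((((a / K : ℕ) : ℤ) + (s : ℤ) - 1) * ((h : ℤ) * a)
          + (K : ℤ) * d * ((a / K : ℕ) : ℤ) - a - d)) ∧
    ((s - 2) * k + 2 ≤ a % K ∧ a % K ≤ (s - 1) * k + 1 →
      IsGreatest {n : ℤ | ¬ ∃ x0 y : ℕ, ∃ x : ℕ → ℕ,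
          n = ((x0 * a + (∑ i ∈ Finset.Icc 1 k, x i * (h * a + i * d))
            + y * (h * a + K * d) : ℕ) : ℤ)}
        ((((a / K : ℕ) : ℤ) + (s : ℤ) - 1) * ((h : ℤ) * a)
          + (K : ℤ) * d * ((a / K : ℕ) : ℤ) - a + (((a % K : ℕ) : ℤ) - 1) * d)) ∧
    ((s - 1) * k + 2 ≤ a % K →
      IsGreatest {n : ℤ | ¬ ∃ x0 y : ℕ, ∃ x : ℕ → ℕ,
          n = ((x0 * a + (∑ i ∈ Finset.Icc 1 k, x i * (h * a + i * d))
            + y * (h * a + K * d) : ℕ) : ℤ)}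
        ((((a / K : ℕ) : ℤ) + (s : ℤ)) * ((h : ℤ) * a)
          + (K : ℤ) * d * ((a / K : ℕ) : ℤ) - a + (((a % K : ℕ) : ℤ) - 1) * d)) := by
  have hk0 : 0 < k := by omega
  have hs2 : 2 ≤ s := by
    by_contra hlt
    obtain rfl : s = 1 := by omega
    omega
  obtain ⟨e, rfl⟩ : ∃ e, s = e + 2 := ⟨s - 2, by omega⟩
  have hK0 : 0 < K := by omega
  have hKs : K ≤ (e + 2) * k + 1 := by omega
  have he1 : (e + 1) * k = e * k + k := by ring
  have he2 : (e + 2) * k = e * k + 2 * k := by ring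
  simp only [show e + 2 - 1 = e + 1 by omega, show e + 2 - 2 = e by omega] at *
  have hdh : d ≤ (e + 1) * h := (ceilDiv_le_iff_le_mul (by omega)).1 hhd
  obtain ⟨q, hq⟩ : ∃ q, a / K = q := ⟨_, rfl⟩
  obtain ⟨j, hj⟩ : ∃ j, a % K = j := ⟨_, rfl⟩
  have haqj : K * q + j = a := by rw [← hq, ← hj]; exact Nat.div_add_mod a K
  have hjK : j < K := hj ▸ Nat.mod_lt _ hK0
  rw [hq, hj]
  have hq1 : 1 ≤ q := by
    rw [← hq, Nat.le_div_iff_mul_le hK0]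
    exact (Nat.mul_le_mul_right K (by omega : 1 ≤ e + 1)).trans ha'
  have hKq : K ≤ K * q := Nat.le_mul_of_pos_right K hq1
  have key : ∀ r R : ℕ, r ≤ R → greedyParts k K r ≤ greedyParts k K R →
      greedyParts k K r * (h * a) + r * d ≤ greedyParts k K R * (h * a) + R * d :=
    fun r R h1 h2 => add_le_add (Nat.mul_le_mul_right _ h2) (Nat.mul_le_mul_right _ h1)
  have hsplit : ∀ r < a, K * q ≤ r → ∃ p, p < j ∧ r = K * q + p ∧
      greedyParts k K r = q + (p ⌈/⌉ k) := fun r hr hqr =>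
    ⟨r - K * q, by omega, by omega, by
      rw [← greedyParts_mul_add (by omega : r - K * q < K)]; congr 1; omega⟩
  have hlast : 1 ≤ j → greedyParts k K (a - 1) = q + ((j - 1) ⌈/⌉ k) := fun h1 => by
    rw [← greedyParts_mul_add (by omega : j - 1 < K)]; congr 1; omega
  -- when `K * q - 1` has no more parts than `a - 1`, the residue `a - 1` is extremal
  have hmax_last : ∀ c, 1 ≤ j → (j - 1) ⌈/⌉ k = c → e + 1 ≤ c →
      ∀ r < a, greedyParts k K r * (h * a) + r * d
        ≤ greedyParts k K (a - 1) * (h * a) + (a - 1) * d := by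
    intro c hj1 hc hec r hr
    refine key _ _ (by omega) ?_
    rw [hlast hj1, hc]
    rcases lt_or_ge r (K * q) with hlt | hge
    · have := greedyParts_le_of_lt hk0 hKs hlt
      omega
    · obtain ⟨p, hpj, -, hp⟩ := hsplit r hr hge
      rw [hp, ← hc]
      have : p ⌈/⌉ k ≤ (j - 1) ⌈/⌉ k := by
        rw [ceilDiv_le_iff_le_mul hk0]
        have := (ceilDiv_le_iff_le_mul hk0).1 (le_refl ((j - 1) ⌈/⌉ k))
        omega
      omega
  have hceil : ∀ p c : ℕ, c * k < p → p ≤ (c + 1) * k → p ⌈/⌉ k = c + 1 := by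
    intro p c h1 h2
    apply le_antisymm
    · rw [ceilDiv_le_iff_le_mul hk0, mul_comm]; exact h2
    · by_contra hlt
      have : p ⌈/⌉ k ≤ c := by omega
      rw [ceilDiv_le_iff_le_mul hk0, mul_comm] at this
      omega
  have hcast : ((a - 1 : ℕ) : ℤ) = (K : ℤ) * q + j - 1 := by
    zify at haqj
    rw [Nat.cast_sub (by omega)]
    push_cast
    linarith
  refine ⟨fun hj1 => ?_, fun ⟨hj1, hj2⟩ => ?_, fun hj1 => ?_⟩
  · have hO : greedyParts k K (K * q - 1) = q + e + 1 := by
      have hpred : K * q - 1 = K * (q - 1) + (K - 1) := by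
        obtain ⟨q', rfl⟩ : ∃ q', q = q' + 1 := ⟨q - 1, by omega⟩
        rw [Nat.add_sub_cancel, mul_add]
        omega
      rw [hpred, greedyParts_mul_add (by omega), hceil (K - 1) (e + 1) (by omega)
        (by change _ ≤ (e + 2) * k; omega)]
      omega
    have hmain := isGreatest_of_apery_max (h := h) hk0 (by omega) hKs hgcd
      (by simpa using ha') (by omega : K * q - 1 < a) ?_
    · convert hmain using 1
      rw [hO]
      push_cast [Nat.cast_sub (by omega : 1 ≤ K * q)]
      ring
    · intro r hr
      rcases lt_or_ge r (K * q) with hlt | hge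
      · refine key _ _ (by omega) ?_
        have := greedyParts_le_of_lt hk0 hKs hlt
        omega
      · obtain ⟨p, hpj, hrp, hp⟩ := hsplit r hr hge
        have hpe : p ⌈/⌉ k ≤ e := by
          rw [ceilDiv_le_iff_le_mul hk0, mul_comm]
          omega
        have hKd : K * d ≤ h * a := calc
          K * d ≤ K * ((e + 1) * h) := Nat.mul_le_mul_left _ hdh
          _ = h * ((e + 1) * K) := by ring
          _ ≤ h * a := Nat.mul_le_mul_left _ ha'
        have h1 : greedyParts k K r * (h * a) ≤ (q + e) * (h * a) :=
          Nat.mul_le_mul_right _ (by omega)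
        have h2 : r * d ≤ (K * q - 1) * d + K * d := by
          rw [← add_mul]
          exact Nat.mul_le_mul_right _ (by omega)
        have h3 : (q + e + 1) * (h * a) = (q + e) * (h * a) + h * a := by ring
        rw [hO]
        omega
  · have hc := hceil (j - 1) e (by omega) (by omega)
    convert isGreatest_of_apery_max (h := h) hk0 (by omega) hKs hgcd
      (by simpa using ha') (by omega) (hmax_last _ (by omega) hc le_rfl) using 1
    rw [hlast (by omega), hc]
    push_cast [hcast]
    ring
  · have hc := hceil (j - 1) (e + 1) (by omega)
      (by change _ ≤ (e + 2) * k; omega)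
    convert isGreatest_of_apery_max (h := h) hk0 (by omega) hKs hgcd
      (by simpa using ha') (by omega) (hmax_last _ (by omega) hc (by omega)) using 1
    rw [hlast (by omega), hc]
    push_cast [hcast]
    ring
end

section
/- Let a ≥ 2 and h,d,k be positive integers with gcd(a,d)=1. Let A(a) = (a, ha+d, ha+2d, ..., ha+kd). Then g(A(a)) = ha(⌊(a−2)/k⌋ + 1) + (d−1)(a−1) − 1. -/
/-- Every `t ≤ k * (m + 1)` splits into at most `m + 1` parts from `{1, …, k}`, and this
splitting evaluates the weighted sum of the generators `c + i * d`. -/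
lemma exists_sum_Icc_eq (k c d t m : ℕ) (hk : 0 < k) (ht : t ≤ k * (m + 1)) :
    ∃ s ≤ m + 1, ∃ x : ℕ → ℕ,
      ∑ i ∈ Finset.Icc 1 k, x i * (c + i * d) = s * c + t * d := by
  have hdiv := Nat.div_add_mod t k
  have hlt := Nat.mod_lt t hk
  have hle : t / k ≤ m + 1 := by
    rw [← Nat.lt_succ_iff, Nat.div_lt_iff_lt_mul hk]
    nlinarith
  by_cases hr : t % k = 0
  · refine ⟨t / k, hle, fun i => if i = k then t / k else 0, ?_⟩
    have hmem : k ∈ Finset.Icc 1 k := by simp; omega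
    simp only [ite_mul, zero_mul, Finset.sum_ite_eq', hmem, if_true]
    rw [hr, add_zero] at hdiv
    nth_rewrite 3 [← hdiv]
    ring
  · refine ⟨t / k + 1, ?_,
      fun i => (if i = k then t / k else 0) + (if i = t % k then 1 else 0), ?_⟩
    · have : t / k < m + 1 := by
        rw [Nat.div_lt_iff_lt_mul hk, mul_comm]
        refine lt_of_le_of_ne (by omega) fun h => hr ?_
        rw [h, Nat.mul_mod_right]
      omega
    have hmem : k ∈ Finset.Icc 1 k := by simp; omega
    have hmem' : t % k ∈ Finset.Icc 1 k := by simp; omega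
    simp only [add_mul (ite _ _ _), ite_mul, zero_mul, Finset.sum_add_distrib,
      Finset.sum_ite_eq', hmem, hmem', if_true]
    nth_rewrite 4 [← hdiv]
    ring

/-- Some multiple `t * d` with `t < a` is congruent to a given integer modulo `a`. -/
lemma exists_lt_dvd_sub_mul (a d : ℕ) (ha : 0 < a) (hgcd : Nat.gcd a d = 1) (n : ℤ) :
    ∃ t : ℕ, t < a ∧ (a : ℤ) ∣ n - t * d := by
  have ha' : (0 : ℤ) < a := by exact_mod_cast ha
  obtain ⟨u, v, huv⟩ : IsCoprime (a : ℤ) d := Nat.isCoprime_iff_coprime.mpr hgcd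
  have h0 := Int.emod_nonneg (n * v) ha'.ne'
  have h1 := Int.emod_lt_of_pos (n * v) ha'
  refine ⟨(n * v % a).toNat, by omega, ?_⟩
  rw [Int.toNat_of_nonneg h0]
  refine ⟨n * u + (n * v / a) * d, ?_⟩
  linear_combination (-n) * huv - (d : ℤ) * Int.emod_add_mul_ediv (n * v) a

theorem stmt_15 (k a h d : ℕ) (hk : 0 < k) (ha : 2 ≤ a) (hh : 0 < h) (hd : 0 < d)
    (hgcd : Nat.gcd a d = 1) :
    IsGreatest {n : ℤ | ¬ ∃ x0 : ℕ, ∃ x : ℕ → ℕ,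
        n = ((x0 * a + ∑ i ∈ Finset.Icc 1 k, x i * (h * a + i * d) : ℕ) : ℤ)}
      ((h : ℤ) * a * ((((a - 2) / k : ℕ) : ℤ) + 1) + ((d : ℤ) - 1) * ((a : ℤ) - 1) - 1) := by
  set q := (a - 2) / k with hq
  have hapos : (0 : ℤ) < a := by exact_mod_cast (by omega : 0 < a)
  constructor
  · rintro ⟨x0, x, hx⟩
    set S := ∑ i ∈ Finset.Icc 1 k, x i with hS
    set T := ∑ i ∈ Finset.Icc 1 k, x i * i with hT
    have hsum : ∑ i ∈ Finset.Icc 1 k, x i * (h * a + i * d) = S * (h * a) + T * d := by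
      rw [hS, hT, Finset.sum_mul, Finset.sum_mul, ← Finset.sum_add_distrib]
      exact Finset.sum_congr rfl fun i _ => by ring
    have hTS : T ≤ S * k := by
      rw [hS, hT, Finset.sum_mul]
      exact Finset.sum_le_sum fun i hi => Nat.mul_le_mul_left _ (Finset.mem_Icc.mp hi).2
    rw [hsum] at hx
    push_cast at hx
    have hdvd : (a : ℤ) ∣ (T + 1) * d := by
      refine ⟨h * (q + 1) + d - 1 - x0 - S * h, ?_⟩
      linear_combination -hx
    have hdvd' : a ∣ T + 1 :=
      Nat.Coprime.dvd_of_dvd_mul_right hgcd (by exact_mod_cast hdvd)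
    have hTa : a ≤ T + 1 := Nat.le_of_dvd (Nat.succ_pos _) hdvd'
    have hqS : q + 1 ≤ S := by
      rw [Nat.succ_le_iff, hq, Nat.div_lt_iff_lt_mul hk]
      omega
    have h1 : (h : ℤ) * a * (q + 1) ≤ h * a * S :=
      mul_le_mul_of_nonneg_left (by exact_mod_cast hqS) (by positivity)
    have h2 : (a : ℤ) * d ≤ (T + 1) * d :=
      mul_le_mul_of_nonneg_right (by exact_mod_cast hTa) (by positivity)
    have h3 : (0 : ℤ) ≤ x0 * a := by positivity
    nlinarith
  · intro n hn
    by_contra! hlt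
    refine hn ?_
    obtain ⟨t, hta, c, hc⟩ := exists_lt_dvd_sub_mul a d (by omega) hgcd n
    have htq : t ≤ k * (q + 1) := by
      have := Nat.lt_mul_div_succ (a - 2) hk
      rw [← hq] at this
      omega
    obtain ⟨s, hs, x, hx⟩ := exists_sum_Icc_eq k (h * a) d t q hk htq
    have h1 : (h : ℤ) * a * s ≤ h * a * (q + 1) :=
      mul_le_mul_of_nonneg_left (by exact_mod_cast hs) (by positivity)
    have h2 : (t + 1 : ℤ) * d ≤ a * d :=
      mul_le_mul_of_nonneg_right (by exact_mod_cast hta) (by positivity)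
    have hnonneg : 0 ≤ c - s * h := by
      have : 0 < (a : ℤ) * (c - s * h + 1) := by nlinarith
      have := pos_of_mul_pos_right this hapos.le
      omega
    refine ⟨(c - s * h).toNat, x, ?_⟩
    rw [hx]
    push_cast [Int.toNat_of_nonneg hnonneg]
    linear_combination hc
end

section
/- Let a,h,d be positive integers with gcd(a,d)=1, a ≥ 588 and h ≥ ⌈d/42⌉. Let A(a) = (a, ha+d, ha+11d, ha+14d) and write j = a mod 14. Then g(A(a)) = (w_j h − 1)a + r_j d + (ha + 14d)(⌊a/14⌋ − 42), where (w_0,...,w_13) = (43,43,43,43,44,44,44,44,44,44,44,44,44,44) and (r_0,...,r_13) = (587,587,589,590,591,592,592,594,595,595,597,598,598,600). -/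
/-- If the largest Apéry element modulo `a` of the semigroup generated by `a, ha+d, ha+11d, ha+14d`
uses `K` coins of total `M`, then the Frobenius number is `K h a + M d - a`. -/
theorem isGreatest_of_coin_bounds (a h d K M : ℕ) (ha : 0 < a) (hgcd : Nat.gcd a d = 1)
    (hda : d ≤ h * a) (hM : M < a) (hMa : a ≤ M + 2)
    (upper : ∀ r < a, ∃ x y z : ℕ, r = x + 11 * y + 14 * z ∧
      ((x + y + z ≤ K ∧ r ≤ M) ∨ x + y + z + 1 ≤ K))
    (exact_count : ∀ x y z : ℕ, x + 11 * y + 14 * z = M → K ≤ x + y + z)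
    (large : 14 * K ≤ M + a) :
    IsGreatest {n : ℤ | ¬ ∃ x0 x1 x2 x3 : ℕ,
        n = ((x0 * a + x1 * (h * a + d) + x2 * (h * a + 11 * d)
          + x3 * (h * a + 14 * d) : ℕ) : ℤ)}
      ((K : ℤ) * (h * a) + M * d - a) := by
  have hcop : IsCoprime (a : ℤ) (d : ℤ) := Nat.isCoprime_iff_coprime.mpr hgcd
  constructor
  · rintro ⟨x0, x, y, z, hn⟩
    push_cast at hn
    have hdvd : (a : ℤ) ∣ ((x + 11 * y + 14 * z : ℤ) - M) * d :=
      ⟨K * h - 1 - x0 - (x + y + z) * h, by linear_combination -hn⟩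
    obtain ⟨m, hm⟩ := hcop.dvd_of_dvd_mul_right hdvd
    have hm0 : 0 ≤ m := by
      by_contra! hneg
      have : (a : ℤ) * m ≤ a * (-1) := by gcongr; omega
      omega
    have hcount : K ≤ x + y + z := by
      rcases hm0.eq_or_lt with rfl | hpos
      · exact exact_count x y z (by omega)
      · have : (a : ℤ) * 1 ≤ a * m := by gcongr; omega
        omega
    have hsum : (M : ℤ) ≤ x + 11 * y + 14 * z := by
      have : (0 : ℤ) ≤ a * m := by positivity
      omega
    have h1 : (K : ℤ) * (h * a) ≤ (x + y + z : ℤ) * (h * a) := by gcongr; exact_mod_cast hcount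
    have h2 : (M : ℤ) * d ≤ (x + 11 * y + 14 * z : ℤ) * d := by gcongr
    have h3 : (0 : ℤ) ≤ x0 * a := by positivity
    have h4 : (0 : ℤ) < a := by exact_mod_cast ha
    linarith
  · intro n hn
    by_contra! hlt
    apply hn
    obtain ⟨u, v, huv⟩ := hcop
    have ha0 : (0 : ℤ) < a := by exact_mod_cast ha
    obtain ⟨r, hr⟩ : ∃ r : ℕ, (r : ℤ) = (n * v) % a :=
      ⟨((n * v) % a).toNat, Int.toNat_of_nonneg (Int.emod_nonneg _ ha0.ne')⟩
    have hra : r < a := by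
      have := Int.emod_lt_of_pos (n * v) ha0
      omega
    have hdiv := Int.emod_add_mul_ediv (n * v) a
    rw [← hr] at hdiv
    obtain ⟨x, y, z, hxyz, hk⟩ := upper r hra
    have hrZ : (r : ℤ) = x + 11 * y + 14 * z := by exact_mod_cast hxyz
    have hcost : (x + y + z : ℤ) * (h * a) + r * d ≤ K * (h * a) + M * d := by
      rcases hk with ⟨hk, hrM⟩ | hk
      · have hk' : (x + y + z : ℤ) ≤ K := by exact_mod_cast hk
        gcongr
      · have h1 : (x + y + z + 1 : ℤ) * (h * a) ≤ K * (h * a) := by gcongr; exact_mod_cast hk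
        have h2 : (r : ℤ) * d ≤ (M + 1) * d := by gcongr; omega
        have h3 : (d : ℤ) ≤ h * a := by exact_mod_cast hda
        linarith
    obtain ⟨c, hc⟩ : (a : ℤ) ∣ n - ((x + y + z : ℤ) * (h * a) + r * d) :=
      ⟨n * u + d * (n * v / a) - (x + y + z) * h, by
        linear_combination (-n) * huv - (d : ℤ) * hdiv⟩
    have hc0 : 0 ≤ c := by
      by_contra! hneg
      have : (a : ℤ) * c ≤ a * (-1) := by gcongr; omega
      linarith
    lift c to ℕ using hc0
    refine ⟨c, x, y, z, ?_⟩
    push_cast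
    linear_combination hc + (d : ℤ) * hrZ

/-- An explicit representation by coins `1, 11, 14`; the list entry at `r % 14` is the least value
of `13 x + 3 y` subject to `x + 11 y ≡ r` modulo `14`. -/
theorem exists_coins_s17 (r : ℕ) (hr : 88 ≤ r) :
    ∃ x y z : ℕ, r = x + 11 * y + 14 * z ∧ 14 * (x + y + z) =
      r + [0, 13, 12, 25, 24, 9, 22, 21, 6, 19, 18, 3, 16, 15].getD (r % 14) 0 := by
  obtain ⟨x, y, hmod, hle, hcost⟩ : ∃ x y : ℕ, (x + 11 * y) % 14 = r % 14 ∧ x + 11 * y ≤ 88 ∧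
      13 * x + 3 * y = [0, 13, 12, 25, 24, 9, 22, 21, 6, 19, 18, 3, 16, 15].getD (r % 14) 0 := by
    have ht : r % 14 < 14 := Nat.mod_lt _ (by norm_num)
    generalize r % 14 = t at ht
    have key : ∀ t < 14, ∃ x < 2, ∃ y < 9, (x + 11 * y) % 14 = t ∧ x + 11 * y ≤ 88 ∧
        13 * x + 3 * y =
          [0, 13, 12, 25, 24, 9, 22, 21, 6, 19, 18, 3, 16, 15].getD t 0 := by decide
    obtain ⟨x, -, y, -, hxy⟩ := key t ht
    exact ⟨x, y, hxy⟩
  refine ⟨x, y, (r - (x + 11 * y)) / 14, by omega, ?_⟩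
  rw [← hcost]
  omega

/-- Coin bounds for totals `r < a = 14 q + j`, with `w` the number of coins in excess of `q - 42`
and `s` the total in excess of `14 (q - 42)` at the extremal residue. -/
theorem coins_upper (q j w s r : ℕ) (hq : 42 ≤ q) (hr : r < 14 * q + j)
    (hj : j < 14)
    (hw : w = [43, 43, 43, 43, 44, 44, 44, 44, 44, 44, 44, 44, 44, 44].getD j 0)
    (hs : s = [587, 587, 589, 590, 591, 592, 592, 594, 595, 595, 597, 598, 598, 600].getD j 0) :
    ∃ x y z : ℕ, r = x + 11 * y + 14 * z ∧
      ((x + y + z ≤ w + (q - 42) ∧ r ≤ s + 14 * (q - 42)) ∨ x + y + z + 1 ≤ w + (q - 42)) := by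
  rcases lt_or_ge r 88 with h88 | h88
  · refine ⟨r % 14, 0, r / 14, by omega, Or.inr ?_⟩
    have : 43 ≤ w := by
      subst hw
      interval_cases j <;> simp
    omega
  · obtain ⟨x, y, z, hxyz, hk⟩ := exists_coins_s17 r h88
    refine ⟨x, y, z, hxyz, ?_⟩
    clear hxyz
    generalize x + y + z = k at *
    have ht : r % 14 < 14 := Nat.mod_lt _ (by norm_num)
    generalize htr : r % 14 = t at *
    interval_cases j <;> simp at hw hs <;> subst hw hs <;>
      interval_cases t <;> simp at hk <;> omega

theorem stmt_17 (a h d : ℕ) (ha : 0 < a) (hh : 0 < h) (hd : 0 < d)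
    (hgcd : Nat.gcd a d = 1) (ha' : 588 ≤ a) (hhd : d ⌈/⌉ 42 ≤ h) :
    IsGreatest {n : ℤ | ¬ ∃ x0 x1 x2 x3 : ℕ,
        n = ((x0 * a + x1 * (h * a + d) + x2 * (h * a + 11 * d)
          + x3 * (h * a + 14 * d) : ℕ) : ℤ)}
      (((([43, 43, 43, 43, 44, 44, 44, 44, 44, 44, 44, 44, 44, 44].getD (a % 14) 0 : ℕ) : ℤ)
            * h - 1) * a
        + (([587, 587, 589, 590, 591, 592, 592, 594, 595, 595, 597, 598, 598,
            600].getD (a % 14) 0 : ℕ) : ℤ) * d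
        + ((h : ℤ) * a + 14 * d) * (((a / 14 : ℕ) : ℤ) - 42)) := by
  have hda : d ≤ h * a := by
    have h1 : d ≤ 42 * h := by
      rw [Nat.ceilDiv_eq_add_pred_div] at hhd
      omega
    nlinarith
  have hq : 42 ≤ a / 14 := by omega
  have hj : a % 14 < 14 := Nat.mod_lt _ (by norm_num)
  have haq : a = 14 * (a / 14) + a % 14 := (Nat.div_add_mod a 14).symm
  generalize hw : [43, 43, 43, 43, 44, 44, 44, 44, 44, 44, 44, 44, 44, 44].getD (a % 14) 0 = w
  generalize hs :
      [587, 587, 589, 590, 591, 592, 592, 594, 595, 595, 597, 598, 598, 600].getD (a % 14) 0 = s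
  have hupper := fun r hr => coins_upper (a / 14) (a % 14) w s r hq hr hj hw.symm hs.symm
  rw [← haq] at hupper
  generalize a / 14 = q at *
  generalize a % 14 = j at *
  obtain ⟨p, rfl⟩ := Nat.exists_eq_add_of_le hq
  rw [Nat.add_sub_cancel_left] at hupper
  have hM : s + 14 * p < a ∧ a ≤ s + 14 * p + 2 ∧ 14 * (w + p) ≤ s + 14 * p + a := by
    interval_cases j <;> simp at hw hs <;> omega
  have hexact : ∀ x y z : ℕ, x + 11 * y + 14 * z = s + 14 * p → w + p ≤ x + y + z := by
    intro x y z hxyz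
    clear hupper
    by_contra! hlt
    have hws : 14 * w ≤ s + 25 := by
      interval_cases j <;> simp at hw hs <;> omega
    obtain rfl : x = 0 := by omega
    have hy : y ≤ 3 := by omega
    interval_cases j <;> simp at hw hs <;> interval_cases y <;> omega
  convert isGreatest_of_coin_bounds a h d (w + p) (s + 14 * p) ha hgcd hda hM.1 hM.2.1 hupper
    hexact hM.2.2 using 1
  push_cast
  ring
end

section
/- Let a,h,d be positive integers with gcd(a,d)=1, a ≥ 153 and h ≥ ⌈d/9⌉. Let A(a) = (a, ha+d, ha+4d, ha+11d, ha+17d) and write j = a mod 17. Then g(A(a)) = (w_j h − 1)a + r_j d + (ha + 17d)(⌊a/17⌋ − 9), where (w_0,...,w_16) = (11,11,11,11,11,11,11,11,12,12,12,12,12,12,12,12,12) and (r_0,...,r_16) = (150,150,150,155,156,156,156,159,160,160,160,160,160,160,166,167,167). -/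
/-- The least number of parts `1, 4, 11, 17` summing to `17 * u + t`, less `u`, for `t < 17` and
`2 ≤ u`. -/
def excess (t : ℕ) : ℕ := [0, 1, 2, 2, 1, 1, 2, 3, 2, 2, 2, 1, 2, 3, 3, 2, 2].getD t 0

/-- The coefficients `w_j` of the Frobenius number formula. -/
def weight (j : ℕ) : ℕ :=
  [11, 11, 11, 11, 11, 11, 11, 11, 12, 12, 12, 12, 12, 12, 12, 12, 12].getD j 0

/-- The coefficients `r_j` of the Frobenius number formula. -/
def shift (j : ℕ) : ℕ :=
  [150, 150, 150, 155, 156, 156, 156, 159, 160, 160, 160, 160, 160, 160, 166, 167, 167].getD j 0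

theorem exists_parts_of_le_one (u t : ℕ) (hu : u ≤ 1) (ht : t < 17) :
    ∃ x1 x2 x3 x4 : ℕ, x1 + 4 * x2 + 11 * x3 + 17 * x4 = 17 * u + t ∧
      x1 + x2 + x3 + x4 ≤ 5 := by
  have hs : ∃ x1 x2 x3 : ℕ, x1 + 4 * x2 + 11 * x3 = t ∧ x1 + x2 + x3 ≤ 4 := by
    by_cases h : t < 11
    · exact ⟨t % 4, t / 4, 0, by omega, by omega⟩
    · exact ⟨(t - 11) % 4, (t - 11) / 4, 1, by omega, by omega⟩
  obtain ⟨x1, x2, x3, hx, hk⟩ := hs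
  exact ⟨x1, x2, x3, u, by omega, by omega⟩

theorem exists_parts_of_two_le (u t : ℕ) (hu : 2 ≤ u) (ht : t < 17) :
    ∃ x1 x2 x3 x4 : ℕ, x1 + 4 * x2 + 11 * x3 + 17 * x4 = 17 * u + t ∧
      x1 + x2 + x3 + x4 = u + excess t := by
  have hbase : ∀ t < 17, ∃ x1 < 3, ∃ x2 < 3, ∃ x3 < 5, ∃ x4 < 3,
      x1 + 4 * x2 + 11 * x3 + 17 * x4 = 17 * 2 + t ∧ x1 + x2 + x3 + x4 = 2 + excess t := by
    decide +kernel
  obtain ⟨x1, -, x2, -, x3, -, x4, -, hx, hk⟩ := hbase t ht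
  exact ⟨x1, x2, x3, x4 + (u - 2), by omega, by omega⟩

/-- Every residue below `a = 17 * q + j` is a sum of few parts `1, 4, 11, 17`. -/
theorem exists_parts (q j s : ℕ) (hq : 9 ≤ q) (hj : j < 17) (hs : s < 17 * q + j) :
    ∃ x1 x2 x3 x4 : ℕ, x1 + 4 * x2 + 11 * x3 + 17 * x4 = s ∧
      (s ≤ shift j + 17 * (q - 9) ∧ x1 + x2 + x3 + x4 ≤ weight j + (q - 9) ∨
        s ≤ shift j + 17 * (q - 9) + 17 ∧ x1 + x2 + x3 + x4 + 1 ≤ weight j + (q - 9)) := by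
  obtain ⟨u, t, ht, rfl⟩ : ∃ u t, t < 17 ∧ s = 17 * u + t :=
    ⟨s / 17, s % 17, by omega, by omega⟩
  have hbound : ∀ j < 17, 150 ≤ shift j ∧ 11 ≤ weight j := by decide
  obtain ⟨hr, hw⟩ := hbound j hj
  by_cases hu : u ≤ 1
  · obtain ⟨x1, x2, x3, x4, hx, hk⟩ := exists_parts_of_le_one u t hu ht
    exact ⟨x1, x2, x3, x4, hx, by omega⟩
  · obtain ⟨x1, x2, x3, x4, hx, hk⟩ := exists_parts_of_two_le u t (by omega) ht
    refine ⟨x1, x2, x3, x4, hx, ?_⟩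
    -- It suffices to treat the two top values of `u`, and everything below them at once.
    have htop : ∀ j < 17, ∀ t < 17,
        (t < j → 153 + t ≤ shift j ∧ 9 + excess t ≤ weight j ∨
          153 + t ≤ shift j + 17 ∧ 9 + excess t + 1 ≤ weight j) ∧
        (136 + t ≤ shift j ∧ 8 + excess t ≤ weight j ∨
          136 + t ≤ shift j + 17 ∧ 8 + excess t + 1 ≤ weight j) ∧
        7 + excess t + 1 ≤ weight j := by decide +kernel
    obtain ⟨h9, h8, h7⟩ := htop j hj t ht
    rcases (by omega : u = q ∨ u + 1 = q ∨ u + 2 ≤ q) with h | h | h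
    · have := h9 (by omega)
      omega
    · omega
    · omega

/-- Any sum of parts `1, 4, 11, 17` in the residue class of `shift j + 17 * (q - 9)` has at least
`weight j + (q - 9)` parts. -/
theorem weight_le_card_parts (q j m x1 x2 x3 x4 : ℕ) (hq : 9 ≤ q) (hj : j < 17)
    (hx : x1 + 4 * x2 + 11 * x3 + 17 * x4 = shift j + 17 * (q - 9) + (17 * q + j) * m) :
    weight j + (q - 9) ≤ x1 + x2 + x3 + x4 := by
  obtain ⟨p, rfl⟩ := Nat.exists_eq_add_of_le hq
  have hdef : ∀ j < 17, 17 * weight j ≤ shift j + 54 := by decide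
  have hdefj := hdef j hj
  rcases Nat.eq_zero_or_pos m with rfl | hm
  · have hle : x1 ≤ 2 ∧ x2 ≤ 3 ∧ x3 ≤ 7 ∨ weight j + p ≤ x1 + x2 + x3 + x4 := by omega
    by_contra hlt
    have hfin : ∀ j < 17, ∀ x1 < 3, ∀ x2 < 4, ∀ x3 < 8, ∀ t < 4,
        16 * x1 + 13 * x2 + 6 * x3 + shift j + 17 * (t + 1) ≠ 17 * weight j := by
      decide +kernel
    exact hfin j hj x1 (by omega) x2 (by omega) x3 (by omega)
      (weight j + p - 1 - (x1 + x2 + x3 + x4)) (by omega) (by omega)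
  · have hle : (17 * (9 + p) + j) * 1 ≤ (17 * (9 + p) + j) * m := Nat.mul_le_mul_left _ hm
    omega

theorem stmt_18 (a h d : ℕ) (ha : 0 < a) (hh : 0 < h) (hd : 0 < d)
    (hgcd : Nat.gcd a d = 1) (ha' : 153 ≤ a) (hhd : d ⌈/⌉ 9 ≤ h) :
    IsGreatest {n : ℤ | ¬ ∃ x0 x1 x2 x3 x4 : ℕ,
        n = ((x0 * a + x1 * (h * a + d) + x2 * (h * a + 4 * d)
          + x3 * (h * a + 11 * d) + x4 * (h * a + 17 * d) : ℕ) : ℤ)}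
      (((([11, 11, 11, 11, 11, 11, 11, 11, 12, 12, 12, 12, 12, 12, 12, 12,
            12].getD (a % 17) 0 : ℕ) : ℤ) * h - 1) * a
        + (([150, 150, 150, 155, 156, 156, 156, 159, 160, 160, 160, 160, 160, 160, 166,
            167, 167].getD (a % 17) 0 : ℕ) : ℤ) * d
        + ((h : ℤ) * a + 17 * d) * (((a / 17 : ℕ) : ℤ) - 9)) := by
  have hH : 17 * d ≤ h * a := by
    have h9 : d ≤ 9 * h := by
      have := (ceilDiv_le_iff_le_mul (by norm_num : 0 < 9)).1 hhd
      omega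
    nlinarith
  obtain ⟨q, hq⟩ : ∃ q, q = a / 17 := ⟨_, rfl⟩
  obtain ⟨j, hj⟩ : ∃ j, j = a % 17 := ⟨_, rfl⟩
  have hq9 : 9 ≤ q := by omega
  have hj17 : j < 17 := by omega
  have haqj : a = 17 * q + j := by omega
  change IsGreatest _ ((((weight (a % 17) : ℕ) : ℤ) * h - 1) * a + ((shift (a % 17) : ℕ) : ℤ) * d
    + ((h : ℤ) * a + 17 * d) * (((a / 17 : ℕ) : ℤ) - 9))
  rw [← hj, ← hq]
  have hra : shift j + 17 * (q - 9) < a := by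
    have hlt : ∀ j < 17, shift j < 153 + j := by decide
    have := hlt j hj17
    omega
  have hlower := weight_le_card_parts q j
  have hupper := fun s => exists_parts q j s hq9 hj17
  rw [← haqj] at hupper
  obtain ⟨w, hw⟩ : ∃ w, w = weight j + (q - 9) := ⟨_, rfl⟩
  obtain ⟨r, hr⟩ : ∃ r, r = shift j + 17 * (q - 9) := ⟨_, rfl⟩
  have hval : (((weight j : ℕ) : ℤ) * h - 1) * a + ((shift j : ℕ) : ℤ) * d
      + ((h : ℤ) * a + 17 * d) * ((q : ℤ) - 9) = w * (h * a) + r * d - a := by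
    rw [hw, hr]
    push_cast [hq9]
    ring
  rw [hval]
  rw [← hr] at hra
  simp only [← hr, ← hw] at hupper
  have hcop : IsCoprime (a : ℤ) (d : ℤ) := Nat.isCoprime_iff_coprime.2 hgcd
  constructor
  · rintro ⟨x0, x1, x2, x3, x4, hx⟩
    push_cast at hx
    have hdvd : (a : ℤ) ∣ ((x1 + 4 * x2 + 11 * x3 + 17 * x4 : ℕ) : ℤ) - (r : ℤ) := by
      refine hcop.dvd_of_dvd_mul_right ⟨w * h - 1 - x0 - (x1 + x2 + x3 + x4) * h, ?_⟩
      push_cast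
      linear_combination -hx
    have hmod : (x1 + 4 * x2 + 11 * x3 + 17 * x4) % a = r := by
      have := (Nat.modEq_iff_dvd.2 hdvd).symm
      rwa [Nat.ModEq, Nat.mod_eq_of_lt hra] at this
    have hdiv := Nat.mod_add_div (x1 + 4 * x2 + 11 * x3 + 17 * x4) a
    rw [hmod] at hdiv
    have hk : w ≤ x1 + x2 + x3 + x4 := by
      rw [hw]
      refine hlower ((x1 + 4 * x2 + 11 * x3 + 17 * x4) / a) x1 x2 x3 x4 hq9 hj17 ?_
      rw [← hr, ← haqj, hdiv]
    have hM : r ≤ x1 + 4 * x2 + 11 * x3 + 17 * x4 := hdiv ▸ Nat.le_add_right _ _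
    have h1 : (w : ℤ) * (h * a) ≤ (x1 + x2 + x3 + x4) * (h * a) := by
      exact_mod_cast Nat.mul_le_mul_right (h * a) hk
    have h2 : (r : ℤ) * d ≤ (x1 + 4 * x2 + 11 * x3 + 17 * x4) * d := by
      exact_mod_cast Nat.mul_le_mul_right d hM
    have h3 : (0 : ℤ) ≤ x0 * a := by positivity
    have h4 : (0 : ℤ) < a := by exact_mod_cast ha
    linarith
  · intro n hn
    by_contra hlt
    rw [not_le] at hlt
    apply hn
    have ha0 : (0 : ℤ) < a := by exact_mod_cast ha
    obtain ⟨u, v, huv⟩ := hcop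
    obtain ⟨s, hs⟩ := Int.eq_ofNat_of_zero_le (Int.emod_nonneg (n * v) ha0.ne')
    have hsa : s < a := by
      have := Int.emod_lt_of_pos (n * v) ha0
      omega
    obtain ⟨x1, x2, x3, x4, hM, hk⟩ := hupper s hsa
    have hcost : (x1 + x2 + x3 + x4) * (h * a) + s * d ≤ w * (h * a) + r * d := by
      rcases hk with ⟨hsr, hkw⟩ | ⟨hsr, hkw⟩
      · exact Nat.add_le_add (Nat.mul_le_mul_right _ hkw) (Nat.mul_le_mul_right _ hsr)
      · have h1 := Nat.mul_le_mul_right (h * a) hkw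
        have h2 := Nat.mul_le_mul_right d hsr
        linarith
    have hdiv := Int.emod_add_mul_ediv (n * v) a
    rw [hs] at hdiv
    obtain ⟨c, hc⟩ : (a : ℤ) ∣ n - (((x1 + x2 + x3 + x4) * (h * a) + s * d : ℕ) : ℤ) := by
      refine ⟨n * u + d * (n * v / a) - (x1 + x2 + x3 + x4) * h, ?_⟩
      push_cast
      linear_combination -n * huv - (d : ℤ) * hdiv
    have hc0 : 0 ≤ c := by
      have hcost' : (((x1 + x2 + x3 + x4) * (h * a) + s * d : ℕ) : ℤ) ≤ w * (h * a) + r * d := by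
        exact_mod_cast hcost
      by_contra hneg
      have : (a : ℤ) * c ≤ a * (-1) := mul_le_mul_of_nonneg_left (by omega) ha0.le
      linarith
    obtain ⟨x0, rfl⟩ := Int.eq_ofNat_of_zero_le hc0
    refine ⟨x0, x1, x2, x3, x4, ?_⟩
    rw [← hM] at hc
    push_cast at hc ⊢
    linear_combination hc
end
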